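/- Let q be a power of a prime p, k = F_q(t), and S = {D_1,...,D_l} nonzero elements of k such that K = k(α_1,...,α_l), with α_i^p − α_i = D_i, is a geometric extension of k. Let γ_S be the cardinality of {(a_1,...,a_l) ∈ F_p^l : a_1 D_1 + ··· + a_l D_l = F^p − F for some F ∈ k}. Let M be the set of monic irreducible polynomials P ∈ F_q[t] (not dividing any denominator of the D_i) with Hasse symbols {D_1/P} = ··· = {D_l/P} = 0. Then the relative density of M exists and equals γ_S / p^l; that is, the limit as N → ∞ of #{P ∈ M : deg P = N}/π(N) equals γ_S/p^l. -/

import Mathlib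

open Polynomial Filter

/-- The Hasse symbol `{D/P} ∈ F_p` of `D ∈ F_q(t)` at a monic irreducible `P ∈ F_q[t]`
(meaningful when `ord_P(D) ≥ 0`, i.e. `P ∤ denom(D)`), defined as
`tr_{F_q/F_p}(tr_{(F_q[t]/(P))/F_q}(D mod P))`, where `D mod P` is computed as
`num(D)·denom(D)⁻¹` in `F_q[t]/(P)`. -/
noncomputable def hasseSymbol (p : ℕ) {Fq : Type} [Field Fq] [Fintype Fq]
    [Algebra (ZMod p) Fq] (P : Polynomial Fq) (D : RatFunc Fq) : ZMod p :=
  Algebra.trace (ZMod p) Fq (Algebra.trace Fq (AdjoinRoot P)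
    (AdjoinRoot.mk P D.num * Ring.inverse (AdjoinRoot.mk P D.denom)))

namespace HasseDensity

section Counting

open scoped Classical

variable (F : Type*) [Field F] [Fintype F]

theorem finite_monic_natDegree (n : ℕ) : {f : F[X] | f.Monic ∧ f.natDegree = n}.Finite := by
  have : Finite (degreeLT F n) := Finite.of_equiv _ (degreeLTEquiv F n).toEquiv.symm
  exact Finite.of_equiv _ (monicEquivDegreeLT n).symm

/-- The monic polynomials of degree `n`. -/
noncomputable def monics (n : ℕ) : Finset F[X] := (finite_monic_natDegree F n).toFinset

/-- The monic irreducible polynomials of degree `n`. -/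
noncomputable def irreds (n : ℕ) : Finset F[X] := (monics F n).filter Irreducible

variable {F}

@[simp] theorem mem_monics {n : ℕ} {f : F[X]} : f ∈ monics F n ↔ f.Monic ∧ f.natDegree = n := by
  simp [monics]

@[simp] theorem mem_irreds {n : ℕ} {f : F[X]} :
    f ∈ irreds F n ↔ (f.Monic ∧ f.natDegree = n) ∧ Irreducible f := by
  simp [irreds]

variable (F) in
theorem card_monics (n : ℕ) : (monics F n).card = Fintype.card F ^ n := by
  have h : (monics F n).card = Nat.card {f : F[X] // f.Monic ∧ f.natDegree = n} := by
    exact (Set.ncard_eq_toFinset_card _ (finite_monic_natDegree F n)).symm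
  rw [h, Nat.card_congr ((monicEquivDegreeLT n).trans (degreeLTEquiv F n).toEquiv)]
  simp

/-- The sum of `χ` over the monic polynomials of degree `n`. -/
noncomputable def coeffSum (χ : F[X] → ℂ) (n : ℕ) : ℂ := ∑ f ∈ monics F n, χ f

/-- The sum of `deg P * χ P ^ k` over the monic irreducible `P` and `k` with `k * deg P = n`. -/
noncomputable def primeSum (χ : F[X] → ℂ) (n : ℕ) : ℂ :=
  ∑ d ∈ n.divisors, ∑ P ∈ irreds F d, (d : ℂ) * χ P ^ (n / d)

theorem card_pow_dvd {n : ℕ} {f P : F[X]} (hf : f ∈ monics F n) (hP : P.Monic)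
    (hPi : Irreducible P) :
    ((Finset.Icc 1 n).filter fun j ↦ P.natDegree ∣ j ∧ P ^ (j / P.natDegree) ∣ f).card =
      (UniqueFactorizationMonoid.normalizedFactors f).count P := by
  have hf0 : f ≠ 0 := (mem_monics.1 hf).1.ne_zero
  have hd : 0 < P.natDegree := hPi.natDegree_pos
  have key : ∀ k, P ^ k ∣ f ↔ k ≤ (UniqueFactorizationMonoid.normalizedFactors f).count P := by
    intro k
    rw [pow_dvd_iff_le_emultiplicity,
      UniqueFactorizationMonoid.emultiplicity_eq_count_normalizedFactors hPi hf0,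
      hP.normalize_eq_self]
    exact Nat.cast_le
  set c := (UniqueFactorizationMonoid.normalizedFactors f).count P
  have hle : c * P.natDegree ≤ n := by
    have := natDegree_le_of_dvd ((key c).2 le_rfl) hf0
    rwa [natDegree_pow, (mem_monics.1 hf).2] at this
  rw [← Nat.add_sub_cancel c 1, ← Nat.card_Icc, eq_comm]
  refine Finset.card_bij (fun k _ ↦ k * P.natDegree) ?_ ?_ ?_
  · intro k hk
    rw [Finset.mem_Icc] at hk
    simp only [Finset.mem_filter, Finset.mem_Icc, dvd_mul_left, true_and,
      Nat.mul_div_cancel _ hd, key]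
    exact ⟨⟨Nat.mul_pos hk.1 hd, (Nat.mul_le_mul_right _ hk.2).trans hle⟩, hk.2⟩
  · intro a _ b _ h
    exact Nat.eq_of_mul_eq_mul_right hd h
  · intro j hj
    simp only [Finset.mem_filter, Finset.mem_Icc, key] at hj
    refine ⟨j / P.natDegree, ?_, Nat.div_mul_cancel hj.2.1⟩
    rw [Finset.mem_Icc]
    exact ⟨Nat.div_pos (Nat.le_of_dvd hj.1.1 hj.2.1) hd, hj.2.2⟩

omit [Fintype F] in
theorem natDegree_eq_sum_count {f : F[X]} (hf : f.Monic) :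
    f.natDegree = ∑ P ∈ (UniqueFactorizationMonoid.normalizedFactors f).toFinset,
      (UniqueFactorizationMonoid.normalizedFactors f).count P * P.natDegree := by
  have hm : ∀ P ∈ UniqueFactorizationMonoid.normalizedFactors f, P.Monic := by
    intro P hP
    have h0 := (UniqueFactorizationMonoid.irreducible_of_normalized_factor P hP).ne_zero
    rw [← UniqueFactorizationMonoid.normalize_normalized_factor P hP]
    exact monic_normalize h0
  have hprod : (UniqueFactorizationMonoid.normalizedFactors f).prod = f :=
    eq_of_monic_of_associated (by simpa using monic_multiset_prod_of_monic _ id (by simpa using hm))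
      hf (UniqueFactorizationMonoid.prod_normalizedFactors hf.ne_zero)
  conv_lhs => rw [← hprod]
  rw [natDegree_multiset_prod_of_monic _ hm, Finset.sum_multiset_map_count]
  simp

theorem sum_pow_dvd {n : ℕ} {f : F[X]} (hf : f ∈ monics F n) :
    ∑ j ∈ Finset.Icc 1 n, ∑ d ∈ j.divisors, ∑ P ∈ irreds F d,
      (if P ^ (j / d) ∣ f then d else 0) = n := by
  set I := (Finset.Icc 1 n).biUnion (irreds F) with hI
  have hmemI : ∀ P, P ∈ I ↔ P.Monic ∧ Irreducible P ∧ P.natDegree ≤ n := by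
    intro P
    simp only [hI, Finset.mem_biUnion, Finset.mem_Icc, mem_irreds]
    constructor
    · rintro ⟨d, hd, ⟨h1, h2⟩, h3⟩
      exact ⟨h1, h3, h2 ▸ hd.2⟩
    · rintro ⟨h1, h2, h3⟩
      exact ⟨_, ⟨h2.natDegree_pos, h3⟩, ⟨h1, rfl⟩, h2⟩
  have h1 : ∀ j ∈ Finset.Icc 1 n, ∑ d ∈ j.divisors, ∑ P ∈ irreds F d,
      (if P ^ (j / d) ∣ f then d else 0) =
      ∑ P ∈ I, if P.natDegree ∣ j ∧ P ^ (j / P.natDegree) ∣ f then P.natDegree else 0 := by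
    intro j hj
    rw [Finset.mem_Icc] at hj
    rw [← Finset.sum_filter_add_sum_filter_not I (fun P ↦ P.natDegree ∣ j)]
    rw [Finset.sum_eq_zero (s := I.filter fun P ↦ ¬ P.natDegree ∣ j), add_zero]
    · rw [← Finset.sum_fiberwise_of_maps_to (s := I.filter fun P ↦ P.natDegree ∣ j)
        (t := j.divisors) (g := natDegree)]
      · refine Finset.sum_congr rfl fun d hd ↦ ?_
        rw [Nat.mem_divisors] at hd
        refine Finset.sum_congr ?_ ?_
        · ext P
          rw [Finset.mem_filter, Finset.mem_filter, hmemI, mem_irreds]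
          constructor
          · rintro ⟨⟨h1, rfl⟩, h3⟩
            exact ⟨⟨⟨h1, h3, (Nat.le_of_dvd (by omega) hd.1).trans hj.2⟩, hd.1⟩, rfl⟩
          · rintro ⟨⟨⟨h1, h2, -⟩, -⟩, h3⟩
            exact ⟨⟨h1, h3⟩, h2⟩
        · intro P hP
          have hPd := (Finset.mem_filter.1 hP).2
          simp [hPd, hd.1]
      · intro P hP
        exact Nat.mem_divisors.2 ⟨(Finset.mem_filter.1 hP).2, by omega⟩
    · intro P hP
      rw [if_neg]
      exact fun h ↦ (Finset.mem_filter.1 hP).2 h.1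
  rw [Finset.sum_congr rfl h1, Finset.sum_comm]
  have h2 : ∀ P ∈ I, (∑ j ∈ Finset.Icc 1 n,
      if P.natDegree ∣ j ∧ P ^ (j / P.natDegree) ∣ f then P.natDegree else 0) =
      (UniqueFactorizationMonoid.normalizedFactors f).count P * P.natDegree := by
    intro P hP
    rw [hmemI] at hP
    rw [← card_pow_dvd hf hP.1 hP.2.1, ← Finset.sum_filter, Finset.sum_const, smul_eq_mul]
  rw [Finset.sum_congr rfl h2]
  rw [mem_monics] at hf
  refine Eq.trans ?_ ((natDegree_eq_sum_count hf.1).symm.trans hf.2)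
  refine (Finset.sum_subset ?_ ?_).symm
  · intro P hP
    rw [Multiset.mem_toFinset] at hP
    have hi := UniqueFactorizationMonoid.irreducible_of_normalized_factor P hP
    rw [hmemI]
    refine ⟨?_, hi, ?_⟩
    · rw [← UniqueFactorizationMonoid.normalize_normalized_factor P hP]
      exact monic_normalize hi.ne_zero
    · exact hf.2 ▸ natDegree_le_of_dvd
        (UniqueFactorizationMonoid.dvd_of_mem_normalizedFactors hP) hf.1.ne_zero
  · intro P _ hP
    rw [Multiset.mem_toFinset] at hP
    rw [Multiset.count_eq_zero_of_notMem hP, zero_mul]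

theorem sum_dvd_eq {χ : F[X] → ℂ} (hmul : ∀ f g : F[X], f.Monic → g.Monic → χ (f * g) = χ f * χ g)
    {n m : ℕ} {g : F[X]} (hg : g ∈ monics F m) (hmn : m ≤ n) :
    ∑ f ∈ monics F n, (if g ∣ f then χ f else 0) = χ g * coeffSum χ (n - m) := by
  rw [mem_monics] at hg
  rw [← Finset.sum_filter, coeffSum, Finset.mul_sum, eq_comm]
  refine Finset.sum_bij (fun f _ ↦ g * f) ?_ ?_ ?_ ?_
  · intro f hf
    rw [mem_monics] at hf
    rw [Finset.mem_filter, mem_monics]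
    refine ⟨⟨hg.1.mul hf.1, ?_⟩, dvd_mul_right _ _⟩
    rw [hg.1.natDegree_mul hf.1]
    omega
  · intro a _ b _ h
    exact mul_left_cancel₀ hg.1.ne_zero h
  · intro f hf
    rw [Finset.mem_filter, mem_monics] at hf
    obtain ⟨⟨hfm, hfn⟩, h, rfl⟩ := hf
    have hh : h.Monic := hg.1.of_mul_monic_left hfm
    refine ⟨h, ?_, rfl⟩
    rw [mem_monics]
    rw [hg.1.natDegree_mul hh] at hfn
    exact ⟨hh, by omega⟩
  · intro f hf
    exact (hmul _ _ hg.1 (mem_monics.1 hf).1).symm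

omit [Fintype F] in
theorem apply_pow {χ : F[X] → ℂ} (hone : χ 1 = 1)
    (hmul : ∀ f g : F[X], f.Monic → g.Monic → χ (f * g) = χ f * χ g) {f : F[X]} (hf : f.Monic)
    (k : ℕ) : χ (f ^ k) = χ f ^ k := by
  induction k with
  | zero => simpa using hone
  | succ k ih => rw [pow_succ, hmul _ _ (hf.pow k) hf, ih, pow_succ]

/-- The logarithmic derivative of the Euler product. -/
theorem mul_coeffSum {χ : F[X] → ℂ} (hone : χ 1 = 1)
    (hmul : ∀ f g : F[X], f.Monic → g.Monic → χ (f * g) = χ f * χ g) (n : ℕ) :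
    (n : ℂ) * coeffSum χ n = ∑ j ∈ Finset.Icc 1 n, primeSum χ j * coeffSum χ (n - j) := by
  have h1 : ∀ j ∈ Finset.Icc 1 n, primeSum χ j * coeffSum χ (n - j) =
      ∑ d ∈ j.divisors, ∑ P ∈ irreds F d, ∑ f ∈ monics F n,
        ((if P ^ (j / d) ∣ f then d else 0 : ℕ) : ℂ) * χ f := by
    intro j hj
    rw [primeSum, Finset.sum_mul]
    refine Finset.sum_congr rfl fun d hd ↦ ?_
    rw [Finset.sum_mul]
    refine Finset.sum_congr rfl fun P hP ↦ ?_
    rw [mem_irreds] at hP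
    have hdj : j / d * d = j := Nat.div_mul_cancel (Nat.dvd_of_mem_divisors hd)
    have := sum_dvd_eq hmul (n := n) (m := j) (g := P ^ (j / d))
      (by rw [mem_monics, natDegree_pow, hP.1.2, hdj]; exact ⟨hP.1.1.pow _, rfl⟩)
      (Finset.mem_Icc.1 hj).2
    rw [apply_pow hone hmul hP.1.1] at this
    rw [mul_assoc, ← this, Finset.mul_sum]
    refine Finset.sum_congr rfl fun f _ ↦ ?_
    split_ifs <;> simp
  rw [Finset.sum_congr rfl h1, coeffSum, Finset.mul_sum]
  have h2 : ∀ j ∈ Finset.Icc 1 n, (∑ d ∈ j.divisors, ∑ P ∈ irreds F d, ∑ f ∈ monics F n,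
        ((if P ^ (j / d) ∣ f then d else 0 : ℕ) : ℂ) * χ f) =
      ∑ f ∈ monics F n, ∑ d ∈ j.divisors, ∑ P ∈ irreds F d,
        ((if P ^ (j / d) ∣ f then d else 0 : ℕ) : ℂ) * χ f := by
    intro j _
    rw [Finset.sum_comm]
    exact Finset.sum_congr rfl fun d _ ↦ Finset.sum_comm
  rw [Finset.sum_congr rfl h2, Finset.sum_comm]
  refine Finset.sum_congr rfl fun f hf ↦ ?_
  simp_rw [← Finset.sum_mul]
  congr 1
  exact_mod_cast (sum_pow_dvd hf).symm

end Counting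

section PowerSums

theorem reverse_X_sub_C {K : Type*} [Field K] (z : K) :
    (X - C z : K[X]).reverse = 1 - C z * X := by
  ext k
  rw [coeff_reverse, natDegree_X_sub_C]
  rcases k with _ | _ | k
  · rw [revAt_le (by omega)]
    simp
  · rw [revAt_le (by omega)]
    simp [coeff_one]
  · rw [revAt_eq_self_of_lt (by omega)]
    simp [coeff_X, coeff_one]

theorem mul_coeff_prod_eq (s : Multiset ℂ) :
    PowerSeries.X * PowerSeries.derivative ℂ
        (s.map fun z ↦ (1 - PowerSeries.C z * PowerSeries.X : PowerSeries ℂ)).prod =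
      (s.map fun z ↦ (1 - PowerSeries.C z * PowerSeries.X : PowerSeries ℂ)).prod *
        PowerSeries.mk fun k ↦ if k = 0 then 0 else -(s.map (· ^ k)).sum := by
  induction s using Multiset.induction_on with
  | empty =>
    have h : (PowerSeries.mk fun _ ↦ 0 : PowerSeries ℂ) = 0 := by
      ext k
      simp
    simp [h]
  | cons z s ih =>
    have h1 : (PowerSeries.mk fun k ↦ if k = 0 then 0 else -((z ::ₘ s).map (· ^ k)).sum) =
        (PowerSeries.mk fun k ↦ if k = 0 then 0 else -(z ^ k)) +
        (PowerSeries.mk fun k ↦ if k = 0 then 0 else -(s.map (· ^ k)).sum) := by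
      ext k
      simp only [PowerSeries.coeff_mk, map_add, Multiset.map_cons, Multiset.sum_cons]
      split_ifs
      · simp
      · ring
    have h2 : (1 - PowerSeries.C z * PowerSeries.X) *
        (PowerSeries.mk fun k ↦ if k = 0 then 0 else -(z ^ k)) =
        -(PowerSeries.C z * PowerSeries.X) := by
      ext k
      rw [sub_mul, one_mul, map_sub, mul_assoc, PowerSeries.coeff_C_mul, map_neg,
        PowerSeries.coeff_C_mul]
      rcases k with _ | _ | k
      · simp
      · simp [PowerSeries.coeff_succ_X_mul]
      · rw [PowerSeries.coeff_succ_X_mul]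
        simp [PowerSeries.coeff_X]
        ring
    have h3 : PowerSeries.derivative ℂ (1 - PowerSeries.C z * PowerSeries.X) =
        -PowerSeries.C z := by
      ext k
      rcases k with _ | k <;> simp
    rw [Multiset.map_cons, Multiset.prod_cons, Derivation.leibniz, h3, h1, smul_eq_mul,
      smul_eq_mul]
    linear_combination (1 - PowerSeries.C z * PowerSeries.X) * ih -
      (s.map fun z ↦ (1 - PowerSeries.C z * PowerSeries.X : PowerSeries ℂ)).prod * h2

theorem eq_neg_powerSum {Λ S : ℕ → ℂ} (h0 : Λ 0 = 1)
    (hrec : ∀ n : ℕ, (n : ℂ) * Λ n = ∑ j ∈ Finset.Icc 1 n, S j * Λ (n - j)) {s : Multiset ℂ}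
    (hs : PowerSeries.mk Λ = (s.map fun z ↦ (1 - PowerSeries.C z * PowerSeries.X)).prod)
    {n : ℕ} (hn : 0 < n) : S n = -(s.map (· ^ n)).sum := by
  have key : ∀ n : ℕ, (n : ℂ) * Λ n =
      ∑ j ∈ Finset.Icc 1 n, -(s.map (· ^ j)).sum * Λ (n - j) := by
    intro n
    have h := congrArg (PowerSeries.coeff n) (mul_coeff_prod_eq s)
    rcases n with _ | n
    · simp
    rw [← hs, mul_comm (PowerSeries.mk Λ), PowerSeries.coeff_succ_X_mul, PowerSeries.coeff_mul,
      Finset.Nat.sum_antidiagonal_eq_sum_range_succ_mk, Finset.range_eq_Ico,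
      Finset.sum_eq_sum_Ico_succ_bot (by omega)] at h
    simp only [PowerSeries.coeff_mk, if_true, zero_mul, zero_add] at h
    rw [PowerSeries.coeff_derivative, PowerSeries.coeff_mk] at h
    rw [mul_comm, Nat.cast_succ, h]
    refine Finset.sum_congr rfl fun j hj ↦ ?_
    have := Finset.mem_Icc.1 hj
    rw [if_neg (by omega)]
  induction n using Nat.strong_induction_on with
  | _ n ih =>
    have h := (hrec n).symm.trans (key n)
    obtain ⟨m, rfl⟩ : ∃ m, n = m + 1 := ⟨n - 1, by omega⟩
    rw [Finset.sum_Icc_succ_top (by omega), Finset.sum_Icc_succ_top (by omega),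
      Finset.sum_congr rfl fun j hj ↦ by
        rw [ih j (by have := Finset.mem_Icc.1 hj; omega) (by have := Finset.mem_Icc.1 hj; omega)]]
      at h
    simpa [h0] using h

theorem exists_prod_eq {Λ : ℕ → ℂ} (h0 : Λ 0 = 1) {m : ℕ} (hm : ∀ n, m < n → Λ n = 0) :
    ∃ s : Multiset ℂ,
      PowerSeries.mk Λ = (s.map fun z ↦ (1 - PowerSeries.C z * PowerSeries.X)).prod ∧
      ((∀ n, (starRingEnd ℂ) (Λ n) = Λ n) → ∀ z ∈ s, (starRingEnd ℂ) z ∈ s) := by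
  set L : ℂ[X] := ∑ i ∈ Finset.range (m + 1), C (Λ (m - i)) * X ^ i with hL
  have hcoeff : ∀ i, L.coeff i = if i < m + 1 then Λ (m - i) else 0 := by
    intro i
    simp [hL, coeff_C_mul, coeff_X_pow]
  have hdeg : L.natDegree = m := by
    refine natDegree_eq_of_le_of_coeff_ne_zero ?_ ?_
    · rw [natDegree_le_iff_coeff_eq_zero]
      intro i hi
      rw [hcoeff, if_neg (by omega)]
    · simp [hcoeff, h0]
  have hmonic : L.Monic := by
    rw [Monic, leadingCoeff, hdeg, hcoeff]
    simp [h0]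
  have hprod := (IsAlgClosed.splits L).eq_prod_roots_of_monic hmonic
  refine ⟨L.roots, ?_, ?_⟩
  · have h1 : PowerSeries.mk Λ = (L.reverse : PowerSeries ℂ) := by
      ext n
      rw [PowerSeries.coeff_mk, Polynomial.coeff_coe, coeff_reverse, hdeg, hcoeff]
      rcases le_or_gt n m with hn | hn
      · rw [revAt_le hn, if_pos (by omega), Nat.sub_sub_self hn]
      · rw [revAt_eq_self_of_lt hn, if_neg (by omega), hm _ hn]
    have h2 : ∀ s : Multiset ℂ, (((s.map fun z ↦ X - C z).prod : ℂ[X]).reverse : PowerSeries ℂ) =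
        (s.map fun z ↦ (1 - PowerSeries.C z * PowerSeries.X : PowerSeries ℂ)).prod := by
      intro s
      induction s using Multiset.induction_on with
      | empty => rw [Multiset.map_zero, Multiset.map_zero, Multiset.prod_zero, Multiset.prod_zero,
          ← C_1, reverse_C, C_1, Polynomial.coe_one]
      | cons z s ih =>
        rw [Multiset.map_cons, Multiset.prod_cons, reverse_mul_of_domain, Polynomial.coe_mul, ih,
          Multiset.map_cons, Multiset.prod_cons, reverse_X_sub_C]
        simp
    rw [h1, ← h2, ← hprod]
  · intro hreal z hz
    rw [mem_roots hmonic.ne_zero, IsRoot.def] at hz ⊢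
    have h1 : L.map (starRingEnd ℂ) = L := by
      ext i : 1
      rw [coeff_map, hcoeff]
      split_ifs
      · exact hreal _
      · simp
    rw [← h1, eval_map, eval₂_hom, hz, map_zero]

end PowerSums

section Recurrence

theorem exists_large_re_pow (t : Finset ℂ) {M : ℕ} (hM : 0 < M) (n₀ : ℕ) :
    ∃ N, n₀ ≤ N ∧ M ∣ N ∧ ∀ z ∈ t, 3 / 4 * ‖z‖ ^ N ≤ (z ^ N).re := by
  let x : t → Circle := fun z ↦ Circle.exp (Complex.arg z) ^ M
  have hU : {y : t → Circle | ∀ z, 3 / 4 < (y z : ℂ).re} ∈ nhds (1 : t → Circle) := by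
    refine IsOpen.mem_nhds ?_ fun z ↦ ?_
    · rw [Set.ofPred_forall]
      exact isOpen_iInter_of_finite fun z ↦ isOpen_lt (by fun_prop) (by fun_prop)
    · norm_num
  obtain ⟨N, hN, hx⟩ := ((mapClusterPt_one_atTop_pow x).frequently hU).forall_exists_of_atTop n₀
  refine ⟨M * N, hN.trans (Nat.le_mul_of_pos_left _ hM), dvd_mul_right _ _, fun z hz ↦ ?_⟩
  have h1 : 3 / 4 < ((x ^ N) ⟨z, hz⟩ : ℂ).re := hx ⟨z, hz⟩
  have h2 : z ^ (M * N) = (‖z‖ ^ (M * N) : ℝ) * ((x ^ N) ⟨z, hz⟩ : ℂ) := by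
    conv_lhs => rw [← Complex.norm_mul_exp_arg_mul_I z, mul_pow]
    simp [x, Circle.coe_exp, pow_mul]
  rw [h2, Complex.re_ofReal_mul, mul_comm]
  gcongr

end Recurrence

section PrimeCount

variable {F : Type*} [Field F] [Fintype F]

theorem primeSum_one {n : ℕ} (hn : 0 < n) :
    primeSum (fun _ : F[X] ↦ 1) n = (Fintype.card F : ℂ) ^ n := by
  have hc : ∀ n, coeffSum (fun _ : F[X] ↦ 1) n = (Fintype.card F : ℂ) ^ n := by
    intro n
    simp [coeffSum, card_monics]
  have hrec := mul_coeffSum (χ := fun _ : F[X] ↦ 1) rfl (by simp)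
  simp_rw [hc] at hrec
  obtain ⟨m, rfl⟩ : ∃ m, n = m + 1 := ⟨n - 1, by omega⟩
  have h := hrec (m + 1)
  have h1 : ∑ j ∈ Finset.Icc 1 m, primeSum (fun _ : F[X] ↦ 1) j *
      (Fintype.card F : ℂ) ^ (m + 1 - j) =
        (Fintype.card F : ℂ) * (m * (Fintype.card F : ℂ) ^ m) := by
    rw [hrec m, Finset.mul_sum]
    refine Finset.sum_congr rfl fun j hj ↦ ?_
    rw [Nat.sub_add_comm (Finset.mem_Icc.1 hj).2, pow_succ]
    ring
  rw [Finset.sum_Icc_succ_top (by omega), h1] at h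
  simp only [Nat.sub_self, pow_zero, mul_one] at h
  push_cast at h
  rw [pow_succ] at h ⊢
  linear_combination -h

theorem sum_divisors_card_irreds {n : ℕ} (hn : 0 < n) :
    ∑ d ∈ n.divisors, d * (irreds F d).card = Fintype.card F ^ n := by
  have h := primeSum_one (F := F) hn
  simp only [primeSum, one_pow, mul_one, Finset.sum_const, nsmul_eq_mul] at h
  rw [← Nat.cast_inj (R := ℂ)]
  push_cast
  rw [← h]
  exact Finset.sum_congr rfl fun d _ ↦ mul_comm _ _

theorem mul_card_irreds_le (n : ℕ) : n * (irreds F n).card ≤ Fintype.card F ^ n := by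
  rcases Nat.eq_zero_or_pos n with rfl | hn
  · simp
  rw [← sum_divisors_card_irreds hn]
  exact Finset.single_le_sum (f := fun d ↦ d * (irreds F d).card) (fun _ _ ↦ Nat.zero_le _)
    (Nat.mem_divisors_self n hn.ne')

theorem sum_properDivisors_le (n : ℕ) :
    ∑ d ∈ n.properDivisors, d * (irreds F d).card ≤ Fintype.card F ^ (n / 2 + 1) := by
  calc ∑ d ∈ n.properDivisors, d * (irreds F d).card
      ≤ ∑ d ∈ n.properDivisors, Fintype.card F ^ d :=
        Finset.sum_le_sum fun d _ ↦ mul_card_irreds_le d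
    _ ≤ ∑ d ∈ Finset.range (n / 2 + 1), Fintype.card F ^ d := by
        refine Finset.sum_le_sum_of_subset fun d hd ↦ ?_
        rw [Nat.mem_properDivisors] at hd
        obtain ⟨⟨k, rfl⟩, hlt⟩ := hd
        have hk : 2 ≤ k := by
          by_contra! h
          interval_cases k <;> omega
        rw [Finset.mem_range, Nat.lt_succ_iff, Nat.le_div_iff_mul_le two_pos]
        exact Nat.mul_le_mul_left _ hk
    _ ≤ Fintype.card F ^ (n / 2 + 1) := (Nat.geomSum_lt Fintype.one_lt_card (by simp)).le

theorem pow_card_le (n : ℕ) (hn : 0 < n) :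
    Fintype.card F ^ n ≤ n * (irreds F n).card + Fintype.card F ^ (n / 2 + 1) := by
  rw [← sum_divisors_card_irreds hn, ← Nat.insert_self_properDivisors hn.ne',
    Finset.sum_insert Nat.self_notMem_properDivisors]
  have := sum_properDivisors_le (F := F) n
  omega

theorem norm_sum_irreds_le {χ : F[X] → ℂ} (hχ : ∀ f, ‖χ f‖ ≤ 1) (d k : ℕ) :
    ‖∑ P ∈ irreds F d, (d : ℂ) * χ P ^ k‖ ≤ d * (irreds F d).card := by
  rw [← Finset.mul_sum, norm_mul, Complex.norm_natCast]
  gcongr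
  refine (norm_sum_le_of_le _ fun P _ ↦ ?_).trans_eq (by simp : _ = ∑ P ∈ irreds F d, (1 : ℝ)).symm
  rw [norm_pow]
  exact pow_le_one₀ (norm_nonneg _) (hχ P)

theorem norm_primeSum_le {χ : F[X] → ℂ} (hχ : ∀ f, ‖χ f‖ ≤ 1) {n : ℕ} (hn : 0 < n) :
    ‖primeSum χ n‖ ≤ (Fintype.card F : ℝ) ^ n := by
  refine (norm_sum_le_of_le _ fun d _ ↦ norm_sum_irreds_le hχ d _).trans_eq ?_
  exact_mod_cast sum_divisors_card_irreds hn

theorem norm_primeSum_sub_le {χ : F[X] → ℂ} (hχ : ∀ f, ‖χ f‖ ≤ 1) {n : ℕ} (hn : 0 < n) :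
    ‖n * ∑ P ∈ irreds F n, χ P - primeSum χ n‖ ≤ (Fintype.card F : ℝ) ^ (n / 2 + 1) := by
  rw [primeSum, ← Nat.insert_self_properDivisors hn.ne',
    Finset.sum_insert Nat.self_notMem_properDivisors, Nat.div_self hn]
  simp_rw [pow_one]
  rw [← Finset.mul_sum (s := irreds F n), norm_sub_rev, add_sub_cancel_left]
  refine (norm_sum_le_of_le _ fun d _ ↦ norm_sum_irreds_le hχ d _).trans ?_
  exact_mod_cast sum_properDivisors_le n

/-- If the prime sums of `χ` are `o(q ^ n)` then the mean of `χ` over primes tends to zero. -/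
theorem tendsto_mean_irreds {χ : F[X] → ℂ} (hχ : ∀ f, ‖χ f‖ ≤ 1)
    (h : Tendsto (fun n ↦ primeSum χ n / (Fintype.card F : ℂ) ^ n) atTop (nhds 0)) :
    Tendsto (fun n ↦ (∑ P ∈ irreds F n, χ P) / ((irreds F n).card : ℂ)) atTop (nhds 0) := by
  obtain ⟨q, hq⟩ : ∃ q : ℝ, q = ((Fintype.card F : ℕ) : ℝ) := ⟨_, rfl⟩
  have hq1 : 1 < q := by
    rw [hq]
    exact_mod_cast Fintype.one_lt_card (α := F)
  have hq0 : 0 < q := by linarith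
  have herr : Tendsto (fun n : ℕ ↦ q ^ (n / 2 + 1) / q ^ n) atTop (nhds 0) := by
    have h1 : Tendsto (fun n : ℕ ↦ q * (q⁻¹) ^ (n / 2)) atTop (nhds (q * 0)) :=
      ((tendsto_pow_atTop_nhds_zero_of_lt_one (by positivity) (inv_lt_one_of_one_lt₀ hq1)).comp
        (Nat.tendsto_div_const_atTop two_ne_zero)).const_mul q
    rw [mul_zero] at h1
    refine squeeze_zero (fun n ↦ by positivity) (fun n ↦ ?_) h1
    rw [div_le_iff₀ (by positivity), inv_pow, mul_assoc, pow_succ, mul_comm]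
    gcongr
    rw [inv_mul_eq_div, le_div_iff₀ (by positivity), ← pow_add]
    exact pow_le_pow_right₀ hq1.le (by omega)
  have hnum : Tendsto (fun n : ℕ ↦ (n * ∑ P ∈ irreds F n, χ P) / (q : ℂ) ^ n) atTop (nhds 0) := by
    have h2 : Tendsto (fun n : ℕ ↦ (n * ∑ P ∈ irreds F n, χ P - primeSum χ n) / (q : ℂ) ^ n)
        atTop (nhds 0) := by
      refine squeeze_zero_norm' ?_ herr
      filter_upwards [eventually_gt_atTop 0] with n hn
      rw [norm_div, norm_pow, Complex.norm_real, Real.norm_of_nonneg hq0.le]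
      gcongr
      rw [hq]
      exact norm_primeSum_sub_le hχ hn
    have h3 := h2.add h
    rw [add_zero] at h3
    refine h3.congr fun n ↦ ?_
    simp only [hq, Complex.ofReal_natCast]
    ring
  have hden : Tendsto (fun n : ℕ ↦ ((n * (irreds F n).card : ℝ) / q ^ n)) atTop (nhds 1) := by
    have h4 : Tendsto (fun n : ℕ ↦ 1 - q ^ (n / 2 + 1) / q ^ n) atTop (nhds 1) := by
      simpa using tendsto_const_nhds.sub herr
    refine tendsto_of_tendsto_of_tendsto_of_le_of_le' h4 tendsto_const_nhds ?_ ?_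
    · filter_upwards [eventually_gt_atTop 0] with n hn
      rw [sub_le_iff_le_add, ← add_div, le_div_iff₀ (by positivity), one_mul, hq]
      exact_mod_cast pow_card_le (F := F) n hn
    · refine .of_forall fun n ↦ ?_
      rw [div_le_one (by positivity), hq]
      exact_mod_cast mul_card_irreds_le (F := F) n
  have hden' : Tendsto (fun n : ℕ ↦ (((n * (irreds F n).card : ℝ) / q ^ n : ℝ) : ℂ)) atTop
      (nhds 1) := by
    have := (Complex.continuous_ofReal.tendsto 1).comp hden
    rw [Complex.ofReal_one] at this
    exact this
  have := hnum.div hden' one_ne_zero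
  rw [zero_div] at this
  refine this.congr' ?_
  filter_upwards [eventually_gt_atTop 0] with n hn
  have hqc : (q : ℂ) ^ n ≠ 0 := pow_ne_zero _ (by exact_mod_cast hq0.ne')
  have hnc : (n : ℂ) ≠ 0 := by exact_mod_cast hn.ne'
  simp only [Pi.div_apply]
  push_cast
  rw [div_div_div_cancel_right₀ hqc, mul_div_mul_left _ _ hnc]

end PrimeCount

section Equidistribution

variable {F : Type*} [Field F] [Fintype F] {p : ℕ} [Fact p.Prime]

open Classical in
/-- The character `f ↦ ψ (a * ℓ f)` of modulus `B`, where `ψ` is the standard additive character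
of `ZMod p`. -/
noncomputable def modChar (B : F[X]) (ℓ : F[X] → ZMod p) (a : ZMod p) (f : F[X]) : ℂ :=
  if IsCoprime f B then ZMod.stdAddChar (a * ℓ f) else 0

variable {B : F[X]} {ℓ : F[X] → ZMod p}

omit [Fintype F] in
theorem norm_modChar_le (a : ZMod p) (f : F[X]) : ‖modChar B ℓ a f‖ ≤ 1 := by
  rw [modChar]
  split_ifs
  · rw [ZMod.stdAddChar_apply, Circle.norm_coe]
  · simp

omit [Fintype F] in
theorem conj_modChar (a : ZMod p) (f : F[X]) :
    (starRingEnd ℂ) (modChar B ℓ a f) = modChar B ℓ (-a) f := by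
  rw [modChar, modChar, apply_ite (starRingEnd ℂ), map_zero]
  congr 1
  rw [neg_mul, AddChar.map_neg_eq_conj]

theorem conj_coeffSum (a : ZMod p) (n : ℕ) :
    (starRingEnd ℂ) (coeffSum (modChar B ℓ a) n) = coeffSum (modChar B ℓ (-a)) n := by
  simp [coeffSum, map_sum, conj_modChar]

theorem conj_primeSum (a : ZMod p) (n : ℕ) :
    (starRingEnd ℂ) (primeSum (modChar B ℓ a) n) = primeSum (modChar B ℓ (-a)) n := by
  simp [primeSum, map_sum, conj_modChar]

open Classical in
omit [Fintype F] in
theorem sum_modChar_pow (f : F[X]) {k : ℕ} (hk : 0 < k) :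
    ∑ a, modChar B ℓ a f ^ k =
      if IsCoprime f B ∧ (k : ZMod p) * ℓ f = 0 then (p : ℂ) else 0 := by
  by_cases h : IsCoprime f B
  · simp only [modChar, h, if_true, true_and]
    have h1 : ∀ a : ZMod p, (ZMod.stdAddChar (a * ℓ f) : ℂ) ^ k =
        ZMod.stdAddChar (a * ((k : ZMod p) * ℓ f)) := by
      intro a
      rw [← AddChar.map_nsmul_eq_pow, nsmul_eq_mul]
      congr 1
      ring
    simp_rw [h1]
    rw [AddChar.sum_mulShift _ (ZMod.isPrimitive_stdAddChar p), ZMod.card]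
    simp
  · simp [modChar, h, hk.ne']

open Classical in
theorem sum_re_primeSum (B : F[X]) (ℓ : F[X] → ZMod p) {n : ℕ} :
    ∑ a, (primeSum (modChar B ℓ a) n).re = ∑ d ∈ n.divisors, ∑ P ∈ irreds F d,
      (d : ℝ) *
        if IsCoprime P B ∧ ((n / d : ℕ) : ZMod p) * ℓ P = 0 then (p : ℝ) else 0 := by
  have h1 : ∑ a, primeSum (modChar B ℓ a) n = ∑ d ∈ n.divisors, ∑ P ∈ irreds F d,
      (d : ℂ) * ∑ a, modChar B ℓ a P ^ (n / d) := by
    simp only [primeSum]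
    rw [Finset.sum_comm]
    refine Finset.sum_congr rfl fun d _ ↦ ?_
    rw [Finset.sum_comm]
    exact Finset.sum_congr rfl fun P _ ↦ (Finset.mul_sum _ _ _).symm
  rw [← Complex.re_sum, h1, Complex.re_sum]
  refine Finset.sum_congr rfl fun d hd ↦ ?_
  rw [Complex.re_sum]
  refine Finset.sum_congr rfl fun P _ ↦ ?_
  rw [sum_modChar_pow P (Nat.div_pos (Nat.divisor_le hd) (Nat.pos_of_mem_divisors hd))]
  split_ifs <;> simp

theorem sum_re_primeSum_pos {P : F[X]} (hP : P.Monic) (hPi : Irreducible P) (hPB : IsCoprime P B)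
    (ℓ : F[X] → ZMod p) {n : ℕ} (hn : 0 < n) (hdvd : p * P.natDegree ∣ n) :
    0 < ∑ a, (primeSum (modChar B ℓ a) n).re := by
  have hp0 : 0 < p := (Fact.out : p.Prime).pos
  rw [sum_re_primeSum]
  refine Finset.sum_pos' (fun d _ ↦ Finset.sum_nonneg fun P _ ↦ by split_ifs <;> positivity)
    ⟨P.natDegree, Nat.mem_divisors.2 ⟨(dvd_mul_left _ _).trans hdvd, hn.ne'⟩, ?_⟩
  refine Finset.sum_pos' (fun P _ ↦ by split_ifs <;> positivity)
    ⟨P, mem_irreds.2 ⟨⟨hP, rfl⟩, hPi⟩, ?_⟩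
  have hd := hPi.natDegree_pos
  have h0 : ((n / P.natDegree : ℕ) : ZMod p) = 0 := by
    rw [ZMod.natCast_eq_zero_iff]
    obtain ⟨k, rfl⟩ := hdvd
    rw [mul_right_comm, Nat.mul_div_cancel _ hd]
    exact dvd_mul_right _ _
  rw [if_pos ⟨hPB, by rw [h0, zero_mul]⟩]
  positivity

omit [Fintype F] in
theorem exists_irreducible_isCoprime (hB : B ≠ 0) :
    ∃ P : F[X], P.Monic ∧ Irreducible P ∧ IsCoprime P B := by
  classical
  have hu : ¬ IsUnit (B * X + 1) := by
    rw [isUnit_iff_degree_eq_zero, degree_add_eq_left_of_degree_lt]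
    · rw [degree_mul, degree_X, degree_eq_natDegree hB]
      exact_mod_cast Nat.succ_ne_zero B.natDegree
    · rw [degree_mul, degree_X, degree_one, degree_eq_natDegree hB]
      exact_mod_cast Nat.succ_pos B.natDegree
  obtain ⟨P, hP, hdvd⟩ := WfDvdMonoid.exists_irreducible_factor hu (by
    intro h
    have := congrArg (eval 0) h
    simp at this)
  refine ⟨normalize P, monic_normalize hP.ne_zero,
    (normalize_associated P).irreducible_iff.2 hP, ?_⟩
  obtain ⟨Q, hQ⟩ := (normalize_associated P).dvd.trans hdvd
  exact ⟨Q, -X, by linear_combination -hQ⟩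

theorem exists_powerSum_modChar
    (hadd : ∀ f g : F[X], f.Monic → g.Monic → IsCoprime f B → IsCoprime g B →
      ℓ (f * g) = ℓ f + ℓ g) {a : ZMod p} {m : ℕ}
    (hvan : ∀ n, m < n → coeffSum (modChar B ℓ a) n = 0) :
    ∃ s : Multiset ℂ, (∀ n, 0 < n → primeSum (modChar B ℓ a) n = -(s.map (· ^ n)).sum) ∧
      (a = -a → ∀ z ∈ s, (starRingEnd ℂ) z ∈ s) := by
  have hℓ1 : ℓ 1 = 0 := by
    have := hadd 1 1 monic_one monic_one isCoprime_one_left isCoprime_one_left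
    rw [one_mul] at this
    simpa using this
  have hone : modChar B ℓ a 1 = 1 := by simp [modChar, isCoprime_one_left, hℓ1]
  have hmul : ∀ f g : F[X], f.Monic → g.Monic →
      modChar B ℓ a (f * g) = modChar B ℓ a f * modChar B ℓ a g := by
    intro f g hf hg
    by_cases h1 : IsCoprime f B
    · by_cases h2 : IsCoprime g B
      · simp only [modChar, h1.mul_left h2, h1, h2, if_true, hadd f g hf hg h1 h2, mul_add,
          AddChar.map_add_eq_mul]
      · simp [modChar, IsCoprime.mul_left_iff, h2]
    · simp [modChar, IsCoprime.mul_left_iff, h1]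
  have h0 : coeffSum (modChar B ℓ a) 0 = 1 := by
    have : monics F 0 = {1} := by
      ext f
      rw [mem_monics, Finset.mem_singleton]
      constructor
      · rintro ⟨h1, h2⟩
        exact h1.natDegree_eq_zero.1 h2
      · rintro rfl
        simp
    rw [coeffSum, this, Finset.sum_singleton, hone]
  obtain ⟨s, hs, hconj⟩ := exists_prod_eq h0 hvan
  refine ⟨s, fun n hn ↦ eq_neg_powerSum h0 (mul_coeffSum hone hmul) hs hn, fun ha ↦ hconj ?_⟩
  intro n
  rw [conj_coeffSum, ← ha]

theorem re_sum_pow (s : Multiset ℂ) (n : ℕ) :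
    ((s.map (· ^ n)).sum).re = (s.map fun z ↦ (z ^ n).re).sum := by
  induction s using Multiset.induction_on with
  | empty => simp
  | cons z s ih => simp [ih]

/-- Nonvanishing on the critical circle: the reciprocal zeros of the `L`-function of a nontrivial
character have absolute value less than `q`. -/
theorem norm_lt_of_powerSum (hB : B ≠ 0) {s : ZMod p → Multiset ℂ}
    (hs : ∀ a ≠ 0, ∀ n, 0 < n → primeSum (modChar B ℓ a) n = -((s a).map (· ^ n)).sum)
    (hconj : ∀ a ≠ 0, a = -a → ∀ z ∈ s a, (starRingEnd ℂ) z ∈ s a) {z : ℂ} (hz : z ∈ s 1) :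
    ‖z‖ < Fintype.card F := by
  classical
  by_contra! hlt
  obtain ⟨P, hP, hPi, hPB⟩ := exists_irreducible_isCoprime hB
  have hp : p.Prime := Fact.out
  obtain ⟨N, hN, hdvd, hre⟩ := exists_large_re_pow (Finset.univ.biUnion fun a ↦ (s a).toFinset)
    (Nat.mul_pos hp.pos hPi.natDegree_pos) 1
  have hre' : ∀ a, ∀ z ∈ s a, 3 / 4 * ‖z‖ ^ N ≤ (z ^ N).re := fun a z hz ↦ hre z (by
    simp only [Finset.mem_biUnion, Finset.mem_univ, true_and, Multiset.mem_toFinset]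
    exact ⟨a, hz⟩)
  have hre0 : ∀ a, ∀ z ∈ s a, 0 ≤ (z ^ N).re := fun a z hz ↦
    le_trans (by positivity) (hre' a z hz)
  have hS : ∀ a ≠ 0, (primeSum (modChar B ℓ a) N).re = -((s a).map fun z ↦ (z ^ N).re).sum := by
    intro a ha
    rw [hs a ha N hN, Complex.neg_re, re_sum_pow]
  have hS0 : ∀ a ≠ 0, (primeSum (modChar B ℓ a) N).re ≤ 0 := by
    intro a ha
    rw [hS a ha, neg_nonpos]
    refine Multiset.sum_nonneg fun x hx ↦ ?_
    obtain ⟨z, hz, rfl⟩ := Multiset.mem_map.1 hx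
    exact hre0 a z hz
  have hpos := sum_re_primeSum_pos hP hPi hPB ℓ hN hdvd
  have hbound : (primeSum (modChar B ℓ 0) N).re ≤ (Fintype.card F : ℝ) ^ N :=
    (Complex.re_le_norm _).trans (norm_primeSum_le (norm_modChar_le 0) hN)
  have hsub : ∀ T : Finset ℂ, T ⊆ (s 1).toFinset →
      (primeSum (modChar B ℓ 1) N).re ≤ -∑ z ∈ T, (z ^ N).re := by
    intro T hT
    rw [hS 1 one_ne_zero, neg_le_neg_iff, Finset.sum_multiset_map_count]
    refine (Finset.sum_le_sum_of_subset_of_nonneg hT fun z hz _ ↦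
      hre0 1 z (Multiset.mem_toFinset.1 hz)).trans (Finset.sum_le_sum fun z hz ↦ ?_)
    rw [nsmul_eq_mul]
    refine le_mul_of_one_le_left (hre0 1 z (Multiset.mem_toFinset.1 hz)) ?_
    exact_mod_cast Multiset.one_le_count_iff_mem.2 (Multiset.mem_toFinset.1 hz)
  have hqN : (Fintype.card F : ℝ) ^ N ≤ ‖z‖ ^ N := by gcongr
  have hq : 0 < (Fintype.card F : ℝ) ^ N := by positivity
  have hzre := hre' 1 z hz
  by_cases hp2 : p = 2
  · subst hp2
    have hsum : ∑ a : ZMod 2, (primeSum (modChar B ℓ a) N).re =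
        (primeSum (modChar B ℓ 0) N).re + (primeSum (modChar B ℓ 1) N).re := Fin.sum_univ_two _
    have hz' : (starRingEnd ℂ) z ∈ s 1 := hconj 1 one_ne_zero rfl z hz
    by_cases hzz : (starRingEnd ℂ) z = z
    · obtain ⟨r, rfl⟩ := Complex.conj_eq_iff_real.1 hzz
      have h1 := hsub {(r : ℂ)} (by simpa using hz)
      have h2 : ((r : ℂ) ^ N).re = ‖(r : ℂ)‖ ^ N := by
        rw [← Complex.ofReal_pow, Complex.ofReal_re, Complex.norm_real, Real.norm_eq_abs,
          (even_iff_two_dvd.2 ((dvd_mul_right _ _).trans hdvd)).pow_abs]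
      rw [Finset.sum_singleton, h2] at h1
      linarith
    · have h1 := hsub {z, (starRingEnd ℂ) z} (by
        intro w hw
        simp only [Finset.mem_insert, Finset.mem_singleton] at hw
        rcases hw with rfl | rfl <;> simpa using ‹_›)
      rw [Finset.sum_pair (Ne.symm hzz), ← map_pow, Complex.conj_re] at h1
      linarith
  · have hne : (1 : ZMod p) ≠ -1 := by
      intro h
      have h2 : ((2 : ℕ) : ZMod p) = 0 := by
        push_cast
        linear_combination h
      rw [ZMod.natCast_eq_zero_iff, Nat.prime_dvd_prime_iff_eq hp Nat.prime_two] at h2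
      exact hp2 h2
    have hneg : (primeSum (modChar B ℓ (-1)) N).re = (primeSum (modChar B ℓ 1) N).re := by
      rw [← conj_primeSum, Complex.conj_re]
    have hsum : ∑ a : ZMod p, (primeSum (modChar B ℓ a) N).re ≤
        ∑ a ∈ ({0, 1, -1} : Finset (ZMod p)), (primeSum (modChar B ℓ a) N).re := by
      rw [← Finset.sum_sdiff (Finset.subset_univ ({0, 1, -1} : Finset (ZMod p)))]
      refine add_le_of_nonpos_left (Finset.sum_nonpos fun a ha ↦ hS0 a ?_)
      rintro rfl
      simp at ha
    rw [Finset.sum_insert (by simp), Finset.sum_pair hne, hneg] at hsum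
    have h1 := hsub {z} (by simpa using hz)
    rw [Finset.sum_singleton] at h1
    linarith

/-- Equidistribution: if all the nontrivial multiples of `ℓ` have vanishing coefficient sums in
large degrees, the mean of `ψ ∘ ℓ` over primes tends to zero. -/
theorem tendsto_mean_modChar (hB : B ≠ 0)
    (hadd : ∀ f g : F[X], f.Monic → g.Monic → IsCoprime f B → IsCoprime g B →
      ℓ (f * g) = ℓ f + ℓ g) {m : ℕ}
    (hvan : ∀ a ≠ 0, ∀ n, m < n → coeffSum (modChar B ℓ a) n = 0) :
    Tendsto (fun n ↦ (∑ P ∈ irreds F n, modChar B ℓ 1 P) / ((irreds F n).card : ℂ))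
      atTop (nhds 0) := by
  have hex : ∀ a : ZMod p, ∃ s : Multiset ℂ, a ≠ 0 →
      (∀ n, 0 < n → primeSum (modChar B ℓ a) n = -(s.map (· ^ n)).sum) ∧
      (a = -a → ∀ z ∈ s, (starRingEnd ℂ) z ∈ s) := by
    intro a
    by_cases ha : a = 0
    · exact ⟨0, fun h ↦ absurd ha h⟩
    · obtain ⟨s, hs⟩ := exists_powerSum_modChar hadd (hvan a ha)
      exact ⟨s, fun _ ↦ hs⟩
  choose s hs using hex
  have hlt : ∀ z ∈ s 1, ‖z‖ < Fintype.card F := fun z hz ↦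
    norm_lt_of_powerSum hB (fun a ha ↦ (hs a ha).1) (fun a ha ↦ (hs a ha).2) hz
  refine tendsto_mean_irreds (norm_modChar_le 1) ?_
  have hq : 0 < (Fintype.card F : ℝ) := by positivity
  have hgen : ∀ t : Multiset ℂ, (∀ z ∈ t, ‖z‖ < Fintype.card F) →
      Tendsto (fun n : ℕ ↦ (t.map (· ^ n)).sum / (Fintype.card F : ℂ) ^ n) atTop (nhds 0) := by
    intro t ht
    induction t using Multiset.induction_on with
    | empty => simp
    | cons z t ih =>
      have h1 : Tendsto (fun n : ℕ ↦ (z / (Fintype.card F : ℂ)) ^ n) atTop (nhds 0) := by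
        refine tendsto_pow_atTop_nhds_zero_of_norm_lt_one ?_
        rw [norm_div, Complex.norm_natCast, div_lt_one hq]
        exact ht z (Multiset.mem_cons_self _ _)
      have h2 := h1.add (ih fun w hw ↦ ht w (Multiset.mem_cons_of_mem hw))
      rw [add_zero] at h2
      refine h2.congr fun n ↦ ?_
      rw [Multiset.map_cons, Multiset.sum_cons, add_div, div_pow]
  have h := (hgen (s 1) hlt).neg
  rw [neg_zero] at h
  refine h.congr' ?_
  filter_upwards [eventually_gt_atTop 0] with n hn
  rw [(hs 1 one_ne_zero).1 n hn, neg_div]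

end Equidistribution

section Residue

variable {K : Type*} [Field K]

/-- The residue functional on `K[X] / (B)`: the coefficient of `X ^ (deg B - 1)` in the remainder
modulo `B`. -/
noncomputable def res (B h : K[X]) : K := (h %ₘ B).coeff (B.natDegree - 1)

theorem res_add (B g h : K[X]) : res B (g + h) = res B g + res B h := by
  rw [res, add_modByMonic, coeff_add, res, res]

theorem res_sub (B g h : K[X]) : res B (g - h) = res B g - res B h := by
  rw [res, sub_modByMonic, coeff_sub, res, res]

theorem res_C_mul (B : K[X]) (c : K) (h : K[X]) : res B (C c * h) = c * res B h := by
  rw [← smul_eq_C_mul, res, smul_modByMonic, coeff_smul, smul_eq_mul, res]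

theorem res_of_dvd {B h : K[X]} (hB : B.Monic) (hdvd : B ∣ h) : res B h = 0 := by
  rw [res, (modByMonic_eq_zero_iff_dvd hB).2 hdvd, coeff_zero]

theorem res_congr {B g h : K[X]} (hB : B.Monic) (hdvd : B ∣ g - h) : res B g = res B h := by
  rw [← sub_eq_zero, ← res_sub, res_of_dvd hB hdvd]

theorem res_of_degree_lt {B h : K[X]} (hB : B.Monic) (hlt : h.degree < B.degree) :
    res B h = h.coeff (B.natDegree - 1) := by
  rw [res, (modByMonic_eq_self_iff hB).2 hlt]

theorem res_map {L : Type*} [Field L] (φ : K →+* L) {B : K[X]} (hB : B.Monic) (h : K[X]) :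
    res (B.map φ) (h.map φ) = φ (res B h) := by
  rw [res, ← map_modByMonic _ hB, coeff_map, natDegree_map, res]

theorem res_mul_mul {P Q : K[X]} (hP : P.Monic) (hQ : Q.Monic) (hP0 : 0 < P.natDegree)
    (h : K[X]) : res (P * Q) (h * Q) = res P h := by
  have h1 : res (P * Q) (h * Q) = res (P * Q) ((h %ₘ P) * Q) := by
    refine res_congr (hP.mul hQ) ?_
    rw [← sub_mul]
    refine mul_dvd_mul_right ⟨h /ₘ P, ?_⟩ Q
    linear_combination -(modByMonic_add_div h P)
  have hlt := degree_modByMonic_lt h hP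
  have hle : (h %ₘ P).natDegree ≤ P.natDegree - 1 :=
    Nat.le_sub_one_of_lt (natDegree_modByMonic_lt h hP (by rintro rfl; simp at hP0))
  rw [h1, res_of_degree_lt (hP.mul hQ), hP.natDegree_mul hQ, Nat.sub_add_comm hP0,
    coeff_mul_add_eq_of_natDegree_le hle le_rfl, hQ.coeff_natDegree, mul_one, res]
  rw [degree_mul, degree_mul]
  exact WithBot.add_lt_add_right (degree_ne_bot.2 hQ.ne_zero) hlt

open Classical in
/-- An inverse of `f` modulo `B`. -/
noncomputable def modInv (B f : K[X]) : K[X] := if h : IsCoprime f B then h.choose else 0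

theorem dvd_mul_modInv {B f : K[X]} (h : IsCoprime f B) : B ∣ f * modInv B f - 1 := by
  obtain ⟨b, hb⟩ := h.choose_spec
  rw [modInv, dif_pos h]
  exact ⟨-b, by linear_combination hb⟩

/-- The residue of `A / B * dlog f` along `B`. -/
noncomputable def dlogRes (A B f : K[X]) : K := res B (A * derivative f * modInv B f)

theorem isCoprime_of_dvd_mul_sub_one {B f v : K[X]} (h : B ∣ f * v - 1) : IsCoprime f B := by
  obtain ⟨c, hc⟩ := h
  exact ⟨v, -c, by linear_combination hc⟩

theorem dlogRes_eq {A B f v : K[X]} (hB : B.Monic) (hv : B ∣ f * v - 1) :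
    dlogRes A B f = res B (A * derivative f * v) := by
  have hf := isCoprime_of_dvd_mul_sub_one hv
  refine res_congr hB ?_
  rw [← mul_sub]
  refine Dvd.dvd.mul_left (hf.symm.dvd_of_dvd_mul_left ?_) _
  convert dvd_sub (dvd_mul_modInv hf) hv using 1
  ring

theorem dlogRes_mul {A B f g : K[X]} (hB : B.Monic) (hf : IsCoprime f B) (hg : IsCoprime g B) :
    dlogRes A B (f * g) = dlogRes A B f + dlogRes A B g := by
  obtain ⟨b, hb⟩ := dvd_mul_modInv hf
  obtain ⟨c, hc⟩ := dvd_mul_modInv hg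
  rw [dlogRes_eq (v := modInv B f * modInv B g) hB
    ⟨b * (g * modInv B g) + c, by linear_combination (g * modInv B g) * hb + hc⟩,
    dlogRes, dlogRes, ← res_add]
  refine res_congr hB ⟨A * derivative f * modInv B f * c + A * derivative g * modInv B g * b, ?_⟩
  rw [derivative_mul]
  linear_combination A * derivative f * modInv B f * hc + A * derivative g * modInv B g * hb

theorem dlogRes_congr {A B f g : K[X]} (hB : B.Monic) (hf : IsCoprime f B)
    (h : B ∣ f - g) (h' : B ∣ derivative f - derivative g) : dlogRes A B f = dlogRes A B g := by
  obtain ⟨b, hb⟩ := dvd_mul_modInv hf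
  obtain ⟨c, hc⟩ := h
  obtain ⟨d, hd⟩ := h'
  rw [dlogRes, dlogRes_eq (f := g) (v := modInv B f) hB
    ⟨b - c * modInv B f, by linear_combination hb - modInv B f * hc⟩]
  exact res_congr hB ⟨A * d * modInv B f, by linear_combination A * modInv B f * hd⟩

theorem dlogRes_map {L : Type*} [Field L] (φ : K →+* L) {A B f : K[X]} (hB : B.Monic)
    (hf : IsCoprime f B) :
    dlogRes (A.map φ) (B.map φ) (f.map φ) = φ (dlogRes A B f) := by
  have h := Polynomial.map_dvd φ (dvd_mul_modInv hf)
  rw [Polynomial.map_sub, Polynomial.map_mul, Polynomial.map_one] at h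
  rw [dlogRes_eq (hB.map φ) h, derivative_map, ← Polynomial.map_mul, ← Polynomial.map_mul,
    res_map φ hB, dlogRes]

theorem dlogRes_one (A B : K[X]) : dlogRes A B 1 = 0 := by
  rw [dlogRes, derivative_one, mul_zero, zero_mul, res, zero_modByMonic, coeff_zero]

theorem dlogRes_X_sub_C {A B : K[X]} (hB : B.Monic) (hlt : A.degree < B.degree) {θ : K}
    (hθ : B.eval θ ≠ 0) : dlogRes A B (X - C θ) = -(A.eval θ / B.eval θ) := by
  rcases eq_or_ne A 0 with rfl | hA
  · simp [dlogRes, res]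
  obtain ⟨W, hW⟩ := X_sub_C_dvd_sub_C_eval (p := B) (a := θ)
  obtain ⟨A₁, hA₁⟩ := X_sub_C_dvd_sub_C_eval (p := A) (a := θ)
  have hCb : C (B.eval θ) * C (B.eval θ)⁻¹ = 1 := by
    rw [← C_mul, mul_inv_cancel₀ hθ, C_1]
  have hB0 : 0 < B.degree := (zero_le_degree_iff.2 hA).trans_lt hlt
  have hBm : ((X - C θ) * W).Monic := by
    rw [← hW]
    exact hB.sub_of_left (degree_C_le.trans_lt hB0)
  have hWm : W.Monic := (monic_X_sub_C θ).of_mul_monic_left hBm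
  have hBd : B.degree = ((W.natDegree + 1 : ℕ) : WithBot ℕ) := by
    rw [← degree_sub_eq_left_of_degree_lt (degree_C_le.trans_lt hB0 : (C (B.eval θ)).degree < _),
      hW, degree_mul, degree_X_sub_C, degree_eq_natDegree hWm.ne_zero, add_comm]
    rfl
  have hA₁d : A₁.degree < (W.natDegree : WithBot ℕ) := by
    have h1 : (A - C (A.eval θ)).degree < B.degree :=
      (degree_sub_le _ _).trans_lt (max_lt hlt (degree_C_le.trans_lt hB0))
    rw [hA₁, degree_mul, degree_X_sub_C, hBd] at h1
    rcases eq_or_ne A₁ 0 with rfl | hne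
    · simp
    · rw [degree_eq_natDegree hne] at h1 ⊢
      norm_cast at h1 ⊢
      omega
  have hWd : W.degree < B.degree := by
    rw [hBd, degree_eq_natDegree hWm.ne_zero]
    exact_mod_cast Nat.lt_succ_self W.natDegree
  rw [dlogRes_eq (v := -(C (B.eval θ)⁻¹ * W)) hB
    ⟨-C (B.eval θ)⁻¹, by linear_combination C (B.eval θ)⁻¹ * hW + hCb⟩]
  rw [show res B (A * derivative (X - C θ) * -(C (B.eval θ)⁻¹ * W)) =
      res B (C (-(B.eval θ)⁻¹) * (C (A.eval θ) * W - C (B.eval θ) * A₁)) from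
    res_congr hB ⟨-C (B.eval θ)⁻¹ * A₁, by
      simp only [derivative_sub, derivative_X, derivative_C, C_neg]
      linear_combination -C (B.eval θ)⁻¹ * W * hA₁ + C (B.eval θ)⁻¹ * A₁ * hW⟩]
  rw [res_C_mul, res_sub, res_C_mul, res_C_mul, res_of_degree_lt hB hWd,
    res_of_degree_lt hB (hA₁d.trans (degree_eq_natDegree hWm.ne_zero ▸ hWd)),
    natDegree_eq_of_degree_eq_some hBd, Nat.add_sub_cancel, hWm.coeff_natDegree,
    coeff_eq_zero_of_degree_lt hA₁d]
  ring

/-- The sum of the `j`-th powers of the roots of `f`. -/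
noncomputable def rootPowerSum (j : ℕ) (f : K[X]) : K :=
  if j = 0 then (f.natDegree : K) else -dlogRes 1 (X ^ j) f.reverse

theorem isCoprime_reverse_X_pow {f : K[X]} (hf : f.Monic) (j : ℕ) :
    IsCoprime f.reverse (X ^ j) := by
  refine IsCoprime.pow_right (IsCoprime.symm ((irreducible_X.coprime_iff_not_dvd).2 ?_))
  rw [X_dvd_iff, coeff_zero_reverse, hf.leadingCoeff]
  exact one_ne_zero

theorem rootPowerSum_mul {f g : K[X]} (hf : f.Monic) (hg : g.Monic) (j : ℕ) :
    rootPowerSum j (f * g) = rootPowerSum j f + rootPowerSum j g := by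
  rw [rootPowerSum, rootPowerSum, rootPowerSum]
  split_ifs
  · rw [hf.natDegree_mul hg, Nat.cast_add]
  · rw [reverse_mul_of_domain, dlogRes_mul (monic_X_pow j) (isCoprime_reverse_X_pow hf j)
      (isCoprime_reverse_X_pow hg j), neg_add]

theorem rootPowerSum_map {L : Type*} [Field L] (φ : K →+* L) {f : K[X]} (hf : f.Monic) (j : ℕ) :
    rootPowerSum j (f.map φ) = φ (rootPowerSum j f) := by
  rw [rootPowerSum, rootPowerSum]
  split_ifs
  · rw [natDegree_map, map_natCast]
  · have := dlogRes_map φ (A := 1) (monic_X_pow j) (isCoprime_reverse_X_pow hf j)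
    rw [Polynomial.map_one, Polynomial.map_pow, map_X] at this
    have hr : (f.map φ).reverse = f.reverse.map φ := by
      ext n
      simp [coeff_reverse]
    rw [map_neg, ← this, hr]

theorem rootPowerSum_one (j : ℕ) : rootPowerSum j (1 : K[X]) = 0 := by
  have := rootPowerSum_mul (monic_one (R := K)) monic_one j
  rw [one_mul] at this
  simpa using this

theorem rootPowerSum_X_sub_C (j : ℕ) (θ : K) : rootPowerSum j (X - C θ) = θ ^ j := by
  rw [rootPowerSum]
  split_ifs with hj
  · simp [hj]
  obtain ⟨i, rfl⟩ := Nat.exists_eq_succ_of_ne_zero hj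
  have hgeom : (1 - C θ * X) * (∑ k ∈ Finset.range (i + 1), (C θ * X) ^ k) =
      1 - (C θ * X) ^ (i + 1) := by
    rw [mul_comm, geom_sum_mul_neg]
  rw [reverse_X_sub_C, dlogRes_eq (v := ∑ k ∈ Finset.range (i + 1), (C θ * X) ^ k)
    (monic_X_pow _) ⟨-C θ ^ (i + 1), by rw [hgeom, Nat.succ_eq_add_one]; ring⟩]
  have hs : (∑ k ∈ Finset.range (i + 1), (C θ * X) ^ k) =
      ∑ k ∈ Finset.range (i + 1), monomial k (θ ^ k) := by
    refine Finset.sum_congr rfl fun k _ ↦ ?_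
    rw [mul_pow, ← C_pow, C_mul_X_pow_eq_monomial]
  have hlt : (∑ k ∈ Finset.range (i + 1), (C θ * X) ^ k).degree < (X ^ (i + 1) : K[X]).degree := by
    rw [hs, degree_X_pow]
    refine (degree_sum_le _ _).trans_lt ((Finset.sup_lt_iff (WithBot.bot_lt_coe _)).2 fun k hk ↦ ?_)
    exact (degree_monomial_le _ _).trans_lt (by exact_mod_cast Finset.mem_range.1 hk)
  rw [show (1 : K[X]) * derivative (1 - C θ * X) * (∑ k ∈ Finset.range (i + 1), (C θ * X) ^ k) =
    C (-θ) * ∑ k ∈ Finset.range (i + 1), (C θ * X) ^ k by simp, res_C_mul,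
    res_of_degree_lt (monic_X_pow _) hlt, hs]
  simp [coeff_monomial, pow_succ, mul_comm]

/-- The sum over the roots of `f` of the values of `g + A / B`. -/
noncomputable def rootSum (g A B f : K[X]) : K :=
  (g.sum fun j c ↦ c * rootPowerSum j f) - dlogRes A B f

theorem rootSum_mul (g A : K[X]) {B f h : K[X]} (hB : B.Monic) (hf : f.Monic) (hh : h.Monic)
    (hfB : IsCoprime f B) (hhB : IsCoprime h B) :
    rootSum g A B (f * h) = rootSum g A B f + rootSum g A B h := by
  simp only [rootSum, dlogRes_mul hB hfB hhB, rootPowerSum_mul hf hh, mul_add,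
    Polynomial.sum_def, Finset.sum_add_distrib]
  ring

theorem rootSum_one (g A B : K[X]) : rootSum g A B 1 = 0 := by
  simp [rootSum, rootPowerSum_one, dlogRes_one, Polynomial.sum_def]

theorem rootSum_map {L : Type*} [Field L] (φ : K →+* L) (g A : K[X]) {B f : K[X]} (hB : B.Monic)
    (hf : f.Monic) (hfB : IsCoprime f B) :
    rootSum (g.map φ) (A.map φ) (B.map φ) (f.map φ) = φ (rootSum g A B f) := by
  rw [rootSum, rootSum, map_sub, dlogRes_map φ hB hfB, Polynomial.sum_def, Polynomial.sum_def,
    support_map_of_injective _ φ.injective, map_sum]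
  simp only [coeff_map, rootPowerSum_map φ hf, map_mul]

theorem rootSum_X_sub_C (g : K[X]) {A B : K[X]} (hB : B.Monic) (hlt : A.degree < B.degree) {θ : K}
    (hθ : B.eval θ ≠ 0) : rootSum g A B (X - C θ) = g.eval θ + A.eval θ / B.eval θ := by
  simp only [rootSum, dlogRes_X_sub_C hB hlt hθ, rootPowerSum_X_sub_C, eval_eq_sum (p := g),
    sub_neg_eq_add]

theorem rootSum_prod (g : K[X]) {A B : K[X]} (hB : B.Monic) (hlt : A.degree < B.degree)
    (s : Multiset K) (hs : ∀ θ ∈ s, B.eval θ ≠ 0) :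
    rootSum g A B (s.map fun θ ↦ X - C θ).prod =
      (s.map fun θ ↦ g.eval θ + A.eval θ / B.eval θ).sum := by
  have hco : ∀ θ, B.eval θ ≠ 0 → IsCoprime (X - C θ) B := fun θ hθ ↦
    ((irreducible_X_sub_C θ).coprime_iff_not_dvd).2 (by rwa [dvd_iff_isRoot])
  induction s using Multiset.induction_on with
  | empty => simpa using rootSum_one g A B
  | cons θ s ih =>
    have hs' : ∀ θ ∈ s, B.eval θ ≠ 0 := fun w hw ↦ hs w (Multiset.mem_cons_of_mem hw)
    have hc : IsCoprime (s.map fun θ ↦ X - C θ).prod B := by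
      refine Multiset.prod_induction (IsCoprime · B) _ (fun _ _ ↦ IsCoprime.mul_left)
        isCoprime_one_left fun f hf ↦ ?_
      obtain ⟨w, hw, rfl⟩ := Multiset.mem_map.1 hf
      exact hco w (hs' w hw)
    rw [Multiset.map_cons, Multiset.prod_cons, Multiset.map_cons, Multiset.sum_cons,
      rootSum_mul g A hB (monic_X_sub_C θ)
        (monic_multiset_prod_of_monic _ _ fun θ _ ↦ monic_X_sub_C θ)
        (hco θ (hs θ (Multiset.mem_cons_self _ _))) hc, ih hs',
      rootSum_X_sub_C g hB hlt (hs θ (Multiset.mem_cons_self _ _))]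

end Residue

section ResidueClass

variable {F : Type*} [Field F] {P : F[X]}

/-- The class modulo `P` of a rational function which is integral at `P`. -/
noncomputable def residueClass (P : F[X]) (D : RatFunc F) : AdjoinRoot P :=
  AdjoinRoot.mk P D.num * Ring.inverse (AdjoinRoot.mk P D.denom)

theorem mk_ne_zero {P M : F[X]} (h : ¬ P ∣ M) : AdjoinRoot.mk P M ≠ 0 :=
  fun h' ↦ h (AdjoinRoot.mk_eq_zero.1 h')

variable [hPi : Fact (Irreducible P)]

theorem residueClass_eq {D : RatFunc F} {N M : F[X]} (hM : ¬ P ∣ M) (hD : ¬ P ∣ D.denom)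
    (h : D.num * M = N * D.denom) :
    residueClass P D = AdjoinRoot.mk P N * (AdjoinRoot.mk P M)⁻¹ := by
  have h' := congrArg (AdjoinRoot.mk P) h
  rw [map_mul, map_mul] at h'
  have h1 := mk_ne_zero hM
  have h2 := mk_ne_zero hD
  rw [residueClass, Ring.inverse_eq_inv]
  field_simp
  linear_combination h'

theorem residueClass_div {N M : F[X]} (hM : ¬ P ∣ M) :
    ¬ P ∣ (algebraMap F[X] (RatFunc F) N / algebraMap F[X] (RatFunc F) M).denom ∧
    residueClass P (algebraMap F[X] (RatFunc F) N / algebraMap F[X] (RatFunc F) M) =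
      AdjoinRoot.mk P N * (AdjoinRoot.mk P M)⁻¹ := by
  have hM0 : M ≠ 0 := by
    rintro rfl
    exact hM (dvd_zero P)
  have h1 : ¬ P ∣ (algebraMap F[X] (RatFunc F) N / algebraMap F[X] (RatFunc F) M).denom :=
    fun h ↦ hM (h.trans (RatFunc.denom_div_dvd N M))
  exact ⟨h1, residueClass_eq hM h1 (RatFunc.num_mul_eq_mul_denom_iff hM0 |>.2 rfl)⟩

theorem not_dvd_denom_add {x y : RatFunc F} (hx : ¬ P ∣ x.denom) (hy : ¬ P ∣ y.denom) :
    ¬ P ∣ (x + y).denom := fun h ↦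
  (hPi.out.prime.dvd_or_dvd (h.trans (RatFunc.denom_add_dvd x y))).elim hx hy

theorem not_dvd_denom_mul {x y : RatFunc F} (hx : ¬ P ∣ x.denom) (hy : ¬ P ∣ y.denom) :
    ¬ P ∣ (x * y).denom := fun h ↦
  (hPi.out.prime.dvd_or_dvd (h.trans (RatFunc.denom_mul_dvd x y))).elim hx hy

theorem not_dvd_denom_algebraMap (N : F[X]) : ¬ P ∣ (algebraMap F[X] (RatFunc F) N).denom := by
  rw [RatFunc.denom_algebraMap]
  exact hPi.out.not_dvd_one

theorem residueClass_algebraMap (N : F[X]) :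
    residueClass P (algebraMap F[X] (RatFunc F) N) = AdjoinRoot.mk P N := by
  rw [residueClass, RatFunc.num_algebraMap, RatFunc.denom_algebraMap, map_one, Ring.inverse_one,
    mul_one]

theorem residueClass_add {x y : RatFunc F} (hx : ¬ P ∣ x.denom) (hy : ¬ P ∣ y.denom) :
    residueClass P (x + y) = residueClass P x + residueClass P y := by
  rw [residueClass_eq (hPi.out.prime.not_dvd_mul hx hy) (not_dvd_denom_add hx hy)
    (RatFunc.num_denom_add x y), residueClass, residueClass, Ring.inverse_eq_inv,
    Ring.inverse_eq_inv, map_add, map_mul, map_mul, map_mul]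
  have h1 := mk_ne_zero hx
  have h2 := mk_ne_zero hy
  field_simp

theorem residueClass_mul {x y : RatFunc F} (hx : ¬ P ∣ x.denom) (hy : ¬ P ∣ y.denom) :
    residueClass P (x * y) = residueClass P x * residueClass P y := by
  rw [residueClass_eq (hPi.out.prime.not_dvd_mul hx hy) (not_dvd_denom_mul hx hy)
    (RatFunc.num_denom_mul x y), residueClass, residueClass, Ring.inverse_eq_inv,
    Ring.inverse_eq_inv, map_mul, map_mul]
  have h1 := mk_ne_zero hx
  have h2 := mk_ne_zero hy
  field_simp

theorem residueClass_pow {x : RatFunc F} (hx : ¬ P ∣ x.denom) (n : ℕ) :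
    ¬ P ∣ (x ^ n).denom ∧ residueClass P (x ^ n) = residueClass P x ^ n := by
  induction n with
  | zero =>
    have h1 := not_dvd_denom_algebraMap (P := P) 1
    have h2 := residueClass_algebraMap (P := P) 1
    rw [map_one] at h1 h2
    rw [pow_zero, pow_zero]
    exact ⟨h1, h2.trans (map_one _)⟩
  | succ n ih =>
    rw [pow_succ, pow_succ, residueClass_mul ih.1 hx, ih.2]
    exact ⟨not_dvd_denom_mul ih.1 hx, rfl⟩

theorem residueClass_neg {x : RatFunc F} (hx : ¬ P ∣ x.denom) :
    ¬ P ∣ (-x).denom ∧ residueClass P (-x) = -residueClass P x := by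
  have h1 := not_dvd_denom_algebraMap (P := P) (-1)
  have h2 := residueClass_algebraMap (P := P) (-1)
  rw [map_neg, map_one] at h1 h2
  have h3 := not_dvd_denom_mul h1 hx
  have h4 := residueClass_mul h1 hx
  rw [neg_one_mul] at h3 h4
  rw [h4, h2, map_neg, map_one, neg_one_mul]
  exact ⟨h3, rfl⟩

theorem residueClass_natCast_mul {x : RatFunc F} (hx : ¬ P ∣ x.denom) (n : ℕ) :
    ¬ P ∣ ((n : RatFunc F) * x).denom ∧
      residueClass P ((n : RatFunc F) * x) = n * residueClass P x := by
  have h1 := not_dvd_denom_algebraMap (P := P) (n : F[X])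
  have h2 := residueClass_algebraMap (P := P) (n : F[X])
  rw [map_natCast] at h1 h2
  rw [residueClass_mul h1 hx, h2, map_natCast]
  exact ⟨not_dvd_denom_mul h1 hx, rfl⟩

theorem residueClass_sum {ι : Type*} (s : Finset ι) {x : ι → RatFunc F}
    (hx : ∀ i ∈ s, ¬ P ∣ (x i).denom) :
    ¬ P ∣ (∑ i ∈ s, x i).denom ∧
      residueClass P (∑ i ∈ s, x i) = ∑ i ∈ s, residueClass P (x i) := by
  classical
  induction s using Finset.induction_on with
  | empty =>
    have h1 := not_dvd_denom_algebraMap (P := P) 0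
    have h2 := residueClass_algebraMap (P := P) 0
    rw [map_zero] at h1 h2
    rw [Finset.sum_empty, Finset.sum_empty]
    exact ⟨h1, h2.trans (map_zero _)⟩
  | insert i s hi ih =>
    have h := ih fun j hj ↦ hx j (Finset.mem_insert_of_mem hj)
    have h' := hx i (Finset.mem_insert_self i s)
    rw [Finset.sum_insert hi, Finset.sum_insert hi, residueClass_add h' h.1, h.2]
    exact ⟨not_dvd_denom_add h' h.1, rfl⟩

/-- The trace of a rational function modulo `P` as a sum over the roots of `P`. -/
theorem trace_residueClass [Finite F] (hP : P.Monic) (g : F[X]) {A B : F[X]} (hB : B.Monic)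
    (hlt : A.degree < B.degree) (hPB : ¬ P ∣ B) :
    Algebra.trace F (AdjoinRoot P)
      (AdjoinRoot.mk P g + AdjoinRoot.mk P A * (AdjoinRoot.mk P B)⁻¹) = rootSum g A B P := by
  have := hP.finite_adjoinRoot
  have hcop : IsCoprime P B := (hPi.out.coprime_iff_not_dvd).2 hPB
  apply (algebraMap F (AlgebraicClosure F)).injective
  have hnodup : (P.aroots (AlgebraicClosure F)).Nodup :=
    nodup_aroots_iff_of_splits hP.ne_zero (IsAlgClosed.splits _) |>.2
      (PerfectField.separable_of_irreducible hPi.out)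
  have hprod : P.map (algebraMap F (AlgebraicClosure F)) =
      ((P.aroots (AlgebraicClosure F)).map fun θ ↦ X - C θ).prod :=
    (IsAlgClosed.splits _).eq_prod_roots_of_monic (hP.map _)
  have hroot : ∀ θ ∈ P.aroots (AlgebraicClosure F),
      (B.map (algebraMap F (AlgebraicClosure F))).eval θ ≠ 0 := by
    intro θ hθ h0
    obtain ⟨a, b, hab⟩ := hcop
    have := congrArg (aeval θ) hab
    rw [map_add, map_mul, map_mul, (mem_aroots.1 hθ).2, ← eval_map_algebraMap B, h0] at this
    simp at this
  rw [← rootSum_map _ g A hB hP hcop, hprod, rootSum_prod _ (hB.map _)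
    (by rwa [degree_map, degree_map]) _ hroot, trace_eq_sum_embeddings (AlgebraicClosure F)]
  have hval : ∀ σ : AdjoinRoot P →ₐ[F] AlgebraicClosure F,
      σ (AdjoinRoot.mk P g + AdjoinRoot.mk P A * (AdjoinRoot.mk P B)⁻¹) =
        (fun θ ↦ (g.map (algebraMap F (AlgebraicClosure F))).eval θ +
          (A.map (algebraMap F (AlgebraicClosure F))).eval θ /
          (B.map (algebraMap F (AlgebraicClosure F))).eval θ) (σ (AdjoinRoot.root P)) := by
    intro σ
    have : ∀ f : F[X], σ (AdjoinRoot.mk P f) =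
        (f.map (algebraMap F (AlgebraicClosure F))).eval (σ (AdjoinRoot.root P)) := by
      intro f
      rw [eval_map_algebraMap, aeval_algHom_apply, AdjoinRoot.aeval_eq]
    rw [map_add, map_mul, map_inv₀, this, this, this]
    simp only [div_eq_mul_inv]
  refine (Finset.sum_congr rfl fun σ _ ↦ hval σ).trans ?_
  generalize (fun θ ↦ (g.map (algebraMap F (AlgebraicClosure F))).eval θ +
          (A.map (algebraMap F (AlgebraicClosure F))).eval θ /
          (B.map (algebraMap F (AlgebraicClosure F))).eval θ) = h
  rw [← Finset.sum_mk _ hnodup]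
  refine Finset.sum_bij (fun σ _ ↦ σ (AdjoinRoot.root P)) ?_ ?_ ?_ fun _ _ ↦ rfl
  · intro σ _
    rw [Finset.mem_mk, mem_aroots, aeval_algHom_apply, AdjoinRoot.aeval_eq, AdjoinRoot.mk_self,
      map_zero]
    exact ⟨hP.ne_zero, rfl⟩
  · intro σ _ τ _ h
    exact AdjoinRoot.algHom_ext h
  · intro θ hθ
    refine ⟨AdjoinRoot.liftAlgHom P (Algebra.ofId F _) θ (mem_aroots.1 hθ).2, Finset.mem_univ _, ?_⟩
    exact AdjoinRoot.liftAlgHom_root ..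

end ResidueClass

section HasseSymbol

variable {p : ℕ} {F : Type} [Field F] [Fintype F] [Algebra (ZMod p) F] {P : F[X]}

theorem hasseSymbol_eq (P : F[X]) (D : RatFunc F) : hasseSymbol p P D =
    Algebra.trace (ZMod p) F (Algebra.trace F (AdjoinRoot P) (residueClass P D)) := rfl

variable [hPi : Fact (Irreducible P)]

theorem hasseSymbol_add {x y : RatFunc F} (hx : ¬ P ∣ x.denom) (hy : ¬ P ∣ y.denom) :
    hasseSymbol p P (x + y) = hasseSymbol p P x + hasseSymbol p P y := by
  simp only [hasseSymbol_eq, residueClass_add hx hy, map_add]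

theorem hasseSymbol_sum {ι : Type*} (s : Finset ι) {x : ι → RatFunc F} (a : ι → ZMod p)
    [NeZero p]
    (hx : ∀ i ∈ s, ¬ P ∣ (x i).denom) :
    hasseSymbol p P (∑ i ∈ s, ((a i).val : RatFunc F) * x i) =
      ∑ i ∈ s, a i * hasseSymbol p P (x i) := by
  rw [hasseSymbol_eq,
    (residueClass_sum s fun i hi ↦ (residueClass_natCast_mul (hx i hi) (a i).val).1).2,
    map_sum, map_sum]
  refine Finset.sum_congr rfl fun i hi ↦ ?_
  rw [(residueClass_natCast_mul (hx i hi) (a i).val).2, ← nsmul_eq_mul, map_nsmul, map_nsmul,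
    nsmul_eq_mul, ZMod.natCast_zmod_val, hasseSymbol_eq]

theorem hasseSymbol_pow_sub [Fact p.Prime] (hP : P.Monic) {x : RatFunc F} (hx : ¬ P ∣ x.denom) :
    ¬ P ∣ (x ^ p - x).denom ∧ hasseSymbol p P (x ^ p - x) = 0 := by
  have := hP.finite_adjoinRoot
  have := hP.free_adjoinRoot
  have h1 := residueClass_pow hx p
  have h2 := residueClass_neg hx
  rw [sub_eq_add_neg, hasseSymbol_eq, residueClass_add h1.1 h2.1, h1.2, h2.2,
    Algebra.trace_trace]
  refine ⟨not_dvd_denom_add h1.1 h2.1, ?_⟩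
  have : Algebra.IsAlgebraic (ZMod p) (AdjoinRoot P) := Algebra.IsAlgebraic.trans (ZMod p) F _
  have h3 := Algebra.trace_eq_of_algEquiv
    (FiniteField.frobeniusAlgEquivOfAlgebraic (ZMod p) (AdjoinRoot P)) (residueClass P x)
  rw [FiniteField.coe_frobeniusAlgEquivOfAlgebraic, ZMod.card] at h3
  rw [map_add, h3, map_neg, add_neg_cancel]

end HasseSymbol

section Shift

variable {F : Type*} [Field F]

theorem rootPowerSum_congr {f g : F[X]} (hf : f.Monic) {n j : ℕ} (hfn : f.natDegree = n)
    (hgn : g.natDegree = n) (hj : j ≤ n) (h : ∀ i ≤ j, f.coeff (n - i) = g.coeff (n - i)) :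
    rootPowerSum j f = rootPowerSum j g := by
  rw [rootPowerSum, rootPowerSum, hfn, hgn]
  split_ifs
  · rfl
  have h1 : X ^ (j + 1) ∣ f.reverse - g.reverse := by
    rw [X_pow_dvd_iff]
    intro i hi
    rw [coeff_sub, coeff_reverse, coeff_reverse, hfn, hgn, revAt_le (by omega),
      h i (by omega), sub_self]
  rw [dlogRes_congr (monic_X_pow j) (isCoprime_reverse_X_pow hf j)
    ((pow_dvd_pow X j.le_succ).trans h1)]
  obtain ⟨c, hc⟩ := h1
  rw [← derivative_sub, hc, derivative_mul, derivative_X_pow]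
  exact dvd_add ⟨C ((j + 1 : ℕ) : F) * c, by simp; ring⟩ ⟨X * derivative c, by ring⟩

theorem rootPowerSum_add_C_mul_X_pow {f : F[X]} (hf : f.Monic) {n m : ℕ} (hfn : f.natDegree = n)
    (hm : 0 < m) (hmn : m ≤ n) (c : F) :
    rootPowerSum m (f + C c * X ^ (n - m)) = rootPowerSum m f - m * c := by
  have hlt : (C c * X ^ (n - m)).degree < f.degree := by
    rw [degree_eq_natDegree hf.ne_zero, hfn]
    refine (degree_C_mul_X_pow_le _ _).trans_lt ?_
    exact_mod_cast (by omega : n - m < n)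
  have hdeg : (f + C c * X ^ (n - m)).natDegree = n := by
    rw [natDegree_add_eq_left_of_degree_lt hlt, hfn]
  have hrev : (f + C c * X ^ (n - m)).reverse = f.reverse + C c * X ^ m := by
    rw [reverse, hdeg, reflect_add, reverse, hfn, reflect_C_mul_X_pow, revAt_le (by omega),
      Nat.sub_sub_self hmn]
  obtain ⟨b, hb⟩ := dvd_mul_modInv (isCoprime_reverse_X_pow hf m)
  have hv : X ∣ modInv (X ^ m) f.reverse - 1 := by
    have h0 := congrArg (coeff · 0) hb
    have hm' : (X ^ m : F[X]).coeff 0 = 0 := by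
      rw [coeff_X_pow, if_neg hm.ne]
    simp only [coeff_sub, mul_coeff_zero, coeff_zero_reverse, hf.leadingCoeff, coeff_one_zero,
      hm', zero_mul, one_mul] at h0
    rw [X_dvd_iff, coeff_sub, coeff_one_zero, h0]
  obtain ⟨d, hd⟩ := hv
  obtain ⟨k, rfl⟩ := Nat.exists_eq_succ_of_ne_zero hm.ne'
  rw [rootPowerSum, rootPowerSum, if_neg hm.ne', if_neg hm.ne', hrev,
    dlogRes_eq (v := modInv (X ^ (k + 1)) f.reverse) (monic_X_pow _)
      ⟨b + C c * modInv (X ^ (k + 1)) f.reverse, by linear_combination hb⟩,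
    show res (X ^ (k + 1)) (1 * derivative (f.reverse + C c * X ^ (k + 1)) *
        modInv (X ^ (k + 1)) f.reverse) =
      res (X ^ (k + 1)) (1 * derivative f.reverse * modInv (X ^ (k + 1)) f.reverse +
        C ((k + 1 : ℕ) * c) * X ^ k) from res_congr (monic_X_pow _) ⟨C ((k + 1 : ℕ) * c) * d, by
          rw [derivative_add, derivative_C_mul, derivative_X_pow, C_mul, Nat.add_sub_cancel]
          linear_combination C ((k + 1 : ℕ) : F) * C c * X ^ k * hd⟩,
    res_add, res_C_mul, res_of_degree_lt (monic_X_pow _) (h := X ^ k), dlogRes]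
  · simp
    ring
  · rw [degree_X_pow, degree_X_pow]
    exact_mod_cast Nat.lt_succ_self k

end Shift

section Vanishing

variable {F : Type*} [Field F] [Fintype F] {p : ℕ} [Fact p.Prime]

theorem coeffSum_eq_zero_of_shift {B : F[X]} {ℓ : F[X] → ZMod p} {n : ℕ} (σ : F[X] → F[X])
    (hmaps : ∀ f ∈ monics F n, σ f ∈ monics F n) (hinj : Set.InjOn σ (monics F n))
    (hcop : ∀ f ∈ monics F n, (IsCoprime (σ f) B ↔ IsCoprime f B)) {s : ZMod p} (hs : s ≠ 0)
    (hshift : ∀ f ∈ monics F n, IsCoprime f B → ℓ (σ f) = ℓ f + s) {a : ZMod p} (ha : a ≠ 0) :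
    coeffSum (modChar B ℓ a) n = 0 := by
  have h1 : coeffSum (modChar B ℓ a) n =
      ZMod.stdAddChar (a * s) * coeffSum (modChar B ℓ a) n := by
    conv_lhs => rw [coeffSum]
    rw [coeffSum, Finset.mul_sum]
    symm
    refine Finset.sum_nbij σ hmaps hinj
      (Finset.surjOn_of_injOn_of_card_le σ hmaps hinj le_rfl) fun f hf ↦ ?_
    by_cases hc : IsCoprime f B
    · rw [modChar, modChar, if_pos hc, if_pos ((hcop f hf).2 hc), hshift f hf hc, mul_add,
        AddChar.map_add_eq_mul, mul_comm]
    · rw [modChar, modChar, if_neg hc, if_neg fun h ↦ hc ((hcop f hf).1 h), mul_zero]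
  have h2 : (ZMod.stdAddChar (a * s) : ℂ) ≠ 1 := by
    intro h
    rw [← AddChar.map_zero_eq_one (ZMod.stdAddChar (N := p))] at h
    exact mul_ne_zero ha hs (ZMod.injective_stdAddChar h)
  have h3 : (1 - (ZMod.stdAddChar (a * s) : ℂ)) * coeffSum (modChar B ℓ a) n = 0 := by
    linear_combination h1
  exact (mul_eq_zero.1 h3).resolve_left (sub_ne_zero.2 h2.symm)

variable [Algebra (ZMod p) F]

/-- The additive function whose value at a prime `P` is the Hasse symbol of `g + A / B`. -/
noncomputable def hasseLog (g A B f : F[X]) : ZMod p :=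
  Algebra.trace (ZMod p) F (rootSum g A B f)

theorem exists_trace_ne_zero : ∃ e : F, Algebra.trace (ZMod p) F e ≠ 0 := by
  obtain ⟨e, he⟩ := Algebra.trace_surjective (ZMod p) F 1
  exact ⟨e, he ▸ one_ne_zero⟩

theorem coeffSum_eq_zero_of_pole (g A : F[X]) {P C₀ : F[X]} {m : ℕ} (hP : P.Monic)
    (hPi : Irreducible P) (hC : C₀.Monic) (hPC : ¬ P ∣ C₀) (hPA : ¬ P ∣ A) (hm : (m : F) ≠ 0)
    {a : ZMod p} (ha : a ≠ 0) {n : ℕ} (hn : 2 * (P ^ m * C₀).natDegree + g.natDegree < n) :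
    coeffSum (modChar (P ^ m * C₀) (hasseLog (p := p) g A (P ^ m * C₀)) a) n = 0 := by
  obtain ⟨e, he⟩ := exists_trace_ne_zero (F := F) (p := p)
  obtain ⟨k, rfl⟩ := Nat.exists_eq_add_one_of_ne_zero
    (show m ≠ 0 by
      rintro rfl
      simp at hm)
  have hB : (P ^ (k + 1) * C₀).Monic := (hP.pow _).mul hC
  have hB2 : ((P ^ (k + 1) * C₀) ^ 2).Monic := hB.pow 2
  have hPd := hPi.natDegree_pos
  have hcop : IsCoprime (A * C ((k + 1 : ℕ) : F) * derivative P * C₀) P := by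
    refine (((IsCoprime.mul_left ?_ ?_).mul_left ?_).mul_left ?_)
    · exact ((hPi.coprime_iff_not_dvd).2 hPA).symm
    · exact isCoprime_of_dvd_mul_sub_one (v := C ((k + 1 : ℕ) : F)⁻¹)
        ⟨0, by rw [← C_mul, mul_inv_cancel₀ hm]; simp⟩
    · exact (PerfectField.separable_of_irreducible hPi).symm
    · exact ((hPi.coprime_iff_not_dvd).2 hPC).symm
  obtain ⟨u, hu⟩ := dvd_mul_modInv hcop
  obtain ⟨w, hw⟩ : ∃ w, w = P ^ (k + 1) * C₀ ^ 2 *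
      (modInv P (A * C ((k + 1 : ℕ) : F) * derivative P * C₀) * (C e * X ^ (P.natDegree - 1))) :=
    ⟨_, rfl⟩
  generalize modInv P (A * C ((k + 1 : ℕ) : F) * derivative P * C₀) = v at hu hw
  have hBw : P ^ (k + 1) * C₀ ∣ w :=
    ⟨C₀ * (v * (C e * X ^ (P.natDegree - 1))), by rw [hw]; ring⟩
  have hcop1 : IsCoprime (1 + w) (P ^ (k + 1) * C₀) :=
    isCoprime_of_dvd_mul_sub_one (v := 1) (by simpa using hBw)
  have hres : dlogRes A (P ^ (k + 1) * C₀) (1 + w) = e := by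
    rw [dlogRes_eq (v := 1) hB (by simpa using hBw),
      show res (P ^ (k + 1) * C₀) (A * derivative (1 + w) * 1) = res (P * (P ^ k * C₀))
        ((A * C ((k + 1 : ℕ) : F) * derivative P * C₀ * (v * (C e * X ^ (P.natDegree - 1)))) *
          (P ^ k * C₀)) from ?_, res_mul_mul hP ((hP.pow k).mul hC) hPd,
      show res P (A * C ((k + 1 : ℕ) : F) * derivative P * C₀ *
        (v * (C e * X ^ (P.natDegree - 1)))) = res P (C e * X ^ (P.natDegree - 1)) from
        res_congr hP ⟨u * (C e * X ^ (P.natDegree - 1)), by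
          linear_combination (C e * X ^ (P.natDegree - 1)) * hu⟩,
      res_C_mul, res_of_degree_lt hP, coeff_X_pow, if_pos rfl, mul_one]
    · rw [degree_X_pow, degree_eq_natDegree hP.ne_zero]
      exact_mod_cast Nat.sub_one_lt hPd.ne'
    · rw [pow_succ', mul_assoc]
      refine res_congr (hP.mul ((hP.pow k).mul hC)) ?_
      generalize v * (C e * X ^ (P.natDegree - 1)) = h at hw
      refine ⟨A * (2 * derivative C₀ * h + C₀ * derivative h), ?_⟩
      rw [hw, derivative_add, derivative_one, derivative_mul, derivative_mul, derivative_pow,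
        derivative_pow]
      simp only [Nat.add_sub_cancel, Nat.cast_ofNat, C_ofNat]
      ring
  have hσ : ∀ f, (P ^ (k + 1) * C₀) ^ 2 ∣ f + (w * f) %ₘ (P ^ (k + 1) * C₀) ^ 2 - f * (1 + w) :=
    fun f ↦ ⟨-((w * f) /ₘ (P ^ (k + 1) * C₀) ^ 2), by
      linear_combination modByMonic_add_div (w * f) ((P ^ (k + 1) * C₀) ^ 2)⟩
  have hlt : ∀ f i, n - g.natDegree ≤ i →
      ((w * f) %ₘ (P ^ (k + 1) * C₀) ^ 2).coeff i = 0 := by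
    intro f i hi
    refine coeff_eq_zero_of_degree_lt ((degree_modByMonic_lt _ hB2).trans_le ?_)
    rw [degree_eq_natDegree hB2.ne_zero, natDegree_pow]
    exact_mod_cast (by omega)
  have hdlt : ∀ f ∈ monics F n, ((w * f) %ₘ (P ^ (k + 1) * C₀) ^ 2).degree < f.degree := by
    intro f hf
    rw [mem_monics] at hf
    refine (degree_modByMonic_lt _ hB2).trans ?_
    rw [degree_eq_natDegree hB2.ne_zero, natDegree_pow, degree_eq_natDegree hf.1.ne_zero, hf.2]
    exact_mod_cast (by omega)
  have hmaps : ∀ f ∈ monics F n, f + (w * f) %ₘ (P ^ (k + 1) * C₀) ^ 2 ∈ monics F n := by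
    intro f hf
    have h := mem_monics.1 hf
    rw [mem_monics]
    exact ⟨h.1.add_of_left (hdlt f hf), by
      rw [natDegree_add_eq_left_of_degree_lt (hdlt f hf), h.2]⟩
  have hBσ : ∀ f, P ^ (k + 1) * C₀ ∣ f + (w * f) %ₘ (P ^ (k + 1) * C₀) ^ 2 - f := by
    intro f
    have := (((dvd_pow_self (P ^ (k + 1) * C₀) two_ne_zero)).trans (hσ f)).add (hBw.mul_left f)
    convert this using 1
    ring
  refine coeffSum_eq_zero_of_shift (fun f ↦ f + (w * f) %ₘ (P ^ (k + 1) * C₀) ^ 2) hmaps ?_ ?_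
    (neg_ne_zero.2 he) ?_ ha
  · intro f _ g _ hfg
    obtain ⟨b, hb⟩ := pow_dvd_pow_of_dvd hBw 2
    have hd : f - g = -((w * (f - g)) %ₘ (P ^ (k + 1) * C₀) ^ 2) := by
      rw [mul_sub, sub_modByMonic]
      linear_combination hfg
    have hwd : (P ^ (k + 1) * C₀) ^ 2 ∣ w * (f - g) :=
      ⟨w * ((w * (f - g)) /ₘ (P ^ (k + 1) * C₀) ^ 2) - b * (f - g), by
        linear_combination w * hd - w * modByMonic_add_div (w * (f - g)) ((P ^ (k + 1) * C₀) ^ 2) -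
          (f - g) * hb⟩
    rw [(modByMonic_eq_zero_iff_dvd hB2).2 hwd, neg_zero] at hd
    exact sub_eq_zero.1 hd
  · intro f _
    obtain ⟨c, hc⟩ := hBσ f
    rw [sub_eq_iff_eq_add'] at hc
    simp only [hc]
    exact IsCoprime.add_mul_left_left_iff
  · intro f hf hfB
    have h := mem_monics.1 hf
    have h' := mem_monics.1 (hmaps f hf)
    rw [hasseLog, hasseLog, ← map_neg, ← map_add]
    congr 1
    have hps : ∀ j ≤ g.natDegree, rootPowerSum j (f + (w * f) %ₘ (P ^ (k + 1) * C₀) ^ 2) =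
        rootPowerSum j f := by
      intro j hj
      refine rootPowerSum_congr h'.1 h'.2 h.2 (by omega) fun i hi ↦ ?_
      rw [coeff_add, hlt f _ (by omega), add_zero]
    have hd : dlogRes A (P ^ (k + 1) * C₀) (f + (w * f) %ₘ (P ^ (k + 1) * C₀) ^ 2) =
        dlogRes A (P ^ (k + 1) * C₀) f + e := by
      rw [← hres, ← dlogRes_mul hB hfB hcop1]
      symm
      refine dlogRes_congr hB (hfB.mul_left hcop1) ?_ ?_
      · rw [dvd_sub_comm]
        exact (dvd_pow_self _ two_ne_zero).trans (hσ f)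
      · rw [dvd_sub_comm, ← derivative_sub]
        obtain ⟨c, hc⟩ := hσ f
        rw [hc, derivative_mul, sq, derivative_mul]
        exact ⟨2 * derivative (P ^ (k + 1) * C₀) * c + P ^ (k + 1) * C₀ * derivative c, by ring⟩
    rw [rootSum, rootSum, hd, Polynomial.sum_def, Polynomial.sum_def,
      Finset.sum_congr rfl fun j hj ↦ by rw [hps j (le_natDegree_of_mem_supp j hj)]]
    ring

theorem coeffSum_eq_zero_of_polynomial {g : F[X]} (hg : (g.natDegree : F) ≠ 0)
    {a : ZMod p} (ha : a ≠ 0) {n : ℕ} (hn : g.natDegree < n) :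
    coeffSum (modChar 1 (hasseLog (p := p) g 0 1) a) n = 0 := by
  obtain ⟨e, he⟩ := exists_trace_ne_zero (F := F) (p := p)
  have hg0 : 0 < g.natDegree := Nat.pos_of_ne_zero fun h ↦ hg (by rw [h, Nat.cast_zero])
  have hlc : g.leadingCoeff ≠ 0 := by
    rw [leadingCoeff_ne_zero]
    rintro rfl
    simp at hg0
  obtain ⟨c, hc⟩ : ∃ c : F, g.leadingCoeff * (g.natDegree * c) = -e :=
    ⟨-e / (g.leadingCoeff * g.natDegree), by field_simp⟩
  have hdlt : ∀ f ∈ monics F n, (C c * X ^ (n - g.natDegree)).degree < f.degree := by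
    intro f hf
    rw [mem_monics] at hf
    rw [degree_eq_natDegree hf.1.ne_zero, hf.2]
    refine (degree_C_mul_X_pow_le _ _).trans_lt ?_
    exact_mod_cast (by omega : n - g.natDegree < n)
  have hmaps : ∀ f ∈ monics F n, f + C c * X ^ (n - g.natDegree) ∈ monics F n := by
    intro f hf
    have h := mem_monics.1 hf
    rw [mem_monics]
    exact ⟨h.1.add_of_left (hdlt f hf), by
      rw [natDegree_add_eq_left_of_degree_lt (hdlt f hf), h.2]⟩
  refine coeffSum_eq_zero_of_shift (fun f ↦ f + C c * X ^ (n - g.natDegree)) hmaps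
    (fun f _ g _ h ↦ add_right_cancel h) (fun f _ ↦ by simp [isCoprime_one_right]) he ?_ ha
  intro f hf _
  have h := mem_monics.1 hf
  have h' := mem_monics.1 (hmaps f hf)
  rw [hasseLog, hasseLog, ← map_add]
  congr 1
  have hd : ∀ f : F[X], dlogRes 0 1 f = 0 := fun f ↦ by simp [dlogRes, res]
  have hps : ∀ j ∈ g.support.erase g.natDegree,
      rootPowerSum j (f + C c * X ^ (n - g.natDegree)) = rootPowerSum j f := by
    intro j hj
    have hle := le_natDegree_of_mem_supp j (Finset.mem_of_mem_erase hj)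
    have hne := Finset.ne_of_mem_erase hj
    refine rootPowerSum_congr h'.1 h'.2 h.2 (by omega) fun i hi ↦ ?_
    rw [coeff_add, coeff_C_mul_X_pow, if_neg (by omega), add_zero]
  rw [rootSum, rootSum, hd, hd, sub_zero, sub_zero, Polynomial.sum_def, Polynomial.sum_def,
    ← Finset.add_sum_erase _ _ (natDegree_mem_support_of_nonzero (leadingCoeff_ne_zero.1 hlc)),
    ← Finset.add_sum_erase _ _ (natDegree_mem_support_of_nonzero (leadingCoeff_ne_zero.1 hlc)),
    rootPowerSum_add_C_mul_X_pow h.1 h.2 hg0 hn.le, coeff_natDegree,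
    Finset.sum_congr rfl fun j hj ↦ by rw [hps j hj]]
  linear_combination -hc

end Vanishing

section Reduction

variable {p : ℕ} [Fact p.Prime] {F : Type} [Field F] [Fintype F] [Algebra (ZMod p) F]

/-- The values at the Hasse symbols of `D` of the standard additive character have mean zero. -/
def HasZeroMean (p : ℕ) [Fact p.Prime] {F : Type} [Field F] [Fintype F] [Algebra (ZMod p) F]
    (D : RatFunc F) : Prop :=
  Tendsto (fun n ↦ (∑ P ∈ irreds F n, (ZMod.stdAddChar (hasseSymbol p P D) : ℂ)) /
    ((irreds F n).card : ℂ)) atTop (nhds 0)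

omit [Fact p.Prime] [Algebra (ZMod p) F] in
theorem eventually_not_dvd {M : F[X]} (hM : M ≠ 0) :
    ∀ᶠ n in atTop, ∀ P ∈ irreds F n, ¬ P ∣ M := by
  filter_upwards [eventually_gt_atTop M.natDegree] with n hn P hP h
  have := natDegree_le_of_dvd h hM
  rw [(mem_irreds.1 hP).1.2] at this
  omega

theorem HasZeroMean.add_pow_sub {D : RatFunc F} (h : HasZeroMean p D) (G : RatFunc F) :
    HasZeroMean p (D + (G ^ p - G)) := by
  refine Tendsto.congr' ?_ h
  filter_upwards [eventually_not_dvd D.denom_ne_zero, eventually_not_dvd G.denom_ne_zero]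
    with n h1 h2
  congr 1
  refine Finset.sum_congr rfl fun P hP ↦ ?_
  have : Fact (Irreducible P) := ⟨(mem_irreds.1 hP).2⟩
  have h3 := hasseSymbol_pow_sub (p := p) (mem_irreds.1 hP).1.1 (h2 P hP)
  rw [hasseSymbol_add (h1 P hP) h3.1, h3.2, add_zero]

theorem hasZeroMean_of_coeffSum {g A B : F[X]} (hB : B.Monic) (hlt : A.degree < B.degree) {m : ℕ}
    (hvan : ∀ a ≠ 0, ∀ n, m < n → coeffSum (modChar B (hasseLog (p := p) g A B) a) n = 0) :
    HasZeroMean p (algebraMap F[X] (RatFunc F) g +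
      algebraMap F[X] (RatFunc F) A / algebraMap F[X] (RatFunc F) B) := by
  refine Tendsto.congr' ?_ (tendsto_mean_modChar hB.ne_zero (fun f h hf hh hfB hhB ↦ ?_) hvan)
  · filter_upwards [eventually_not_dvd hB.ne_zero] with n h1
    congr 1
    refine Finset.sum_congr rfl fun P hP ↦ ?_
    have hP' := mem_irreds.1 hP
    have : Fact (Irreducible P) := ⟨hP'.2⟩
    have h2 := residueClass_div (N := A) (h1 P hP)
    rw [modChar, if_pos ((hP'.2.coprime_iff_not_dvd).2 (h1 P hP)), one_mul, hasseSymbol_eq,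
      residueClass_add (not_dvd_denom_algebraMap g) h2.1, residueClass_algebraMap, h2.2,
      trace_residueClass hP'.1.1 g hB hlt (h1 P hP), hasseLog]
  · rw [hasseLog, rootSum_mul g A hB hf hh hfB hhB, map_add, hasseLog, hasseLog]

omit [Fintype F] in
theorem natCast_ne_zero_of_not_dvd {m : ℕ} (h : ¬ p ∣ m) : (m : F) ≠ 0 := by
  have : CharP F p := charP_of_injective_algebraMap (algebraMap (ZMod p) F).injective p
  rwa [Ne, CharP.cast_eq_zero_iff F p]

theorem hasZeroMean_of_pole {D : RatFunc F} {P C₀ : F[X]} {m : ℕ} (hP : P.Monic)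
    (hPi : Irreducible P) (hC : C₀.Monic) (hPC : ¬ P ∣ C₀) (hm : ¬ p ∣ m)
    (hD : D.denom = P ^ m * C₀) : HasZeroMean p D := by
  have hB := (hP.pow m).mul hC
  have hPB : P ∣ D.denom := by
    rw [hD]
    exact (dvd_pow_self P (by rintro rfl; simp at hm)).mul_right _
  have hPA : ¬ P ∣ D.num %ₘ (P ^ m * C₀) := by
    intro h
    have h1 : P ∣ D.num := by
      rw [← modByMonic_add_div D.num (P ^ m * C₀)]
      exact h.add ((hD ▸ hPB).mul_right _)
    exact hPi.not_isUnit (D.isCoprime_num_denom.isUnit_of_dvd' h1 hPB)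
  have h := hasZeroMean_of_coeffSum (p := p) (g := D.num /ₘ (P ^ m * C₀)) hB
    (degree_modByMonic_lt D.num hB) fun a ha n hn ↦
      coeffSum_eq_zero_of_pole (p := p) _ _ hP hPi hC hPC hPA (natCast_ne_zero_of_not_dvd hm) ha hn
  convert h using 1
  have hB0 := RatFunc.algebraMap_ne_zero hB.ne_zero
  have h1 := congrArg (algebraMap F[X] (RatFunc F)) (modByMonic_add_div D.num (P ^ m * C₀))
  rw [map_add, map_mul] at h1
  conv_lhs => rw [← RatFunc.num_div_denom D, hD]
  rw [div_eq_iff hB0, add_mul, div_mul_cancel₀ _ hB0, ← h1]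
  ring

theorem hasZeroMean_of_polynomial {g : F[X]} (hg : ¬ p ∣ g.natDegree) :
    HasZeroMean p (algebraMap F[X] (RatFunc F) g) := by
  have h := hasZeroMean_of_coeffSum (p := p) (g := g) (A := 0) monic_one (by simp)
    fun a ha n hn ↦ coeffSum_eq_zero_of_polynomial (p := p) (natCast_ne_zero_of_not_dvd hg) ha hn
  simpa using h

theorem exists_pow_eq (L : Type*) [Field L] [Finite L] [Algebra (ZMod p) L] (x : L) :
    ∃ y, y ^ p = x := by
  have : CharP L p := charP_of_injective_algebraMap (algebraMap (ZMod p) L).injective p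
  exact surjective_frobenius L p x

theorem polynomial_hasZeroMean_or (g : F[X]) : HasZeroMean p (algebraMap F[X] (RatFunc F) g) ∨
    ∃ (G : RatFunc F) (c : F),
      algebraMap F[X] (RatFunc F) g = G ^ p - G + algebraMap F[X] (RatFunc F) (C c) := by
  have hp : p.Prime := Fact.out
  induction hd : g.natDegree using Nat.strong_induction_on generalizing g with
  | _ d ih =>
    rcases Nat.eq_zero_or_pos d with rfl | hd0
    · refine .inr ⟨0, g.coeff 0, ?_⟩
      rw [← eq_C_of_natDegree_eq_zero hd, zero_pow hp.ne_zero, sub_zero, zero_add]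
    by_cases hdvd : p ∣ d
    · obtain ⟨s, rfl⟩ := hdvd
      obtain ⟨y, hy⟩ := exists_pow_eq (p := p) F g.leadingCoeff
      have hs : 0 < s := Nat.pos_of_mul_pos_left hd0
      have hlt : (g - C g.leadingCoeff * X ^ g.natDegree + C y * X ^ s).natDegree < p * s := by
        have hsp : s < p * s := lt_mul_of_one_lt_left hs hp.one_lt
        have haux : ∀ f : F[X], f.degree < (p * s : ℕ) → f.natDegree < p * s := by
          intro f hf
          rcases eq_or_ne f 0 with rfl | hf0
          · rwa [natDegree_zero]
          · exact (natDegree_lt_iff_degree_lt hf0).2 hf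
        refine haux _ ((degree_add_le _ _).trans_lt (max_lt ?_ ?_))
        · have hg0 : g ≠ 0 := by
            rintro rfl
            rw [natDegree_zero] at hd
            exact hd0.ne hd
          have h1 : (C g.leadingCoeff * X ^ g.natDegree).degree = g.degree := by
            rw [degree_C_mul_X_pow _ (leadingCoeff_ne_zero.2 hg0), degree_eq_natDegree hg0]
          refine (degree_sub_lt_left h1.symm hg0 (by simp)).trans_le ?_
          rw [← hd]
          exact degree_le_natDegree
        · refine (degree_C_mul_X_pow_le _ _).trans_lt ?_
          exact_mod_cast hsp
      have heq : algebraMap F[X] (RatFunc F) g =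
          algebraMap F[X] (RatFunc F) (g - C g.leadingCoeff * X ^ g.natDegree + C y * X ^ s) +
            (algebraMap F[X] (RatFunc F) (C y * X ^ s) ^ p -
              algebraMap F[X] (RatFunc F) (C y * X ^ s)) := by
        rw [← map_pow, ← map_sub, ← map_add, hd, ← hy, C_pow]
        congr 1
        ring
      rcases ih _ hlt _ rfl with h | ⟨G, c, h⟩
      · rw [heq]
        exact .inl (h.add_pow_sub _)
      · refine .inr ⟨G + algebraMap F[X] (RatFunc F) (C y * X ^ s), c, ?_⟩
        have : CharP F p := charP_of_injective_algebraMap (algebraMap (ZMod p) F).injective p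
        rw [heq, h, add_pow_char]
        ring
    · exact .inl (hasZeroMean_of_polynomial (hd ▸ hdvd))

theorem hasZeroMean_or (D : RatFunc F) : HasZeroMean p D ∨
    ∃ (G : RatFunc F) (c : F), D = G ^ p - G + algebraMap F[X] (RatFunc F) (C c) := by
  have hp : p.Prime := Fact.out
  induction hd : D.denom.natDegree using Nat.strong_induction_on generalizing D with
  | _ d ih =>
    by_cases hu : IsUnit D.denom
    · have h1 : D = algebraMap F[X] (RatFunc F) D.num := by
        conv_lhs => rw [← RatFunc.num_div_denom D]
        rw [(RatFunc.monic_denom D).eq_one_of_isUnit hu, map_one, div_one]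
      rw [h1]
      exact polynomial_hasZeroMean_or _
    obtain ⟨P, hP, hPi, hPd⟩ : ∃ P : F[X], P.Monic ∧ Irreducible P ∧ P ∣ D.denom :=
      exists_monic_irreducible_factor _ hu
    obtain ⟨C₀, hDd, hPC⟩ :=
      (FiniteMultiplicity.of_prime_left hPi.prime D.denom_ne_zero).exists_eq_pow_mul_and_not_dvd
    generalize multiplicity P D.denom = m at hDd
    have hC : C₀.Monic := (hP.pow m).of_mul_monic_left (hDd ▸ RatFunc.monic_denom D)
    by_cases hm : p ∣ m
    · obtain ⟨s, rfl⟩ := hm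
      have : Fact (Irreducible P) := ⟨hPi⟩
      have := hP.finite_adjoinRoot
      have : Finite (AdjoinRoot P) := Module.finite_of_finite F
      have : CharP F p := charP_of_injective_algebraMap (algebraMap (ZMod p) F).injective p
      have hm0 : p * s ≠ 0 := by
        intro h0
        rw [h0, pow_zero, one_mul] at hDd
        exact hPC (hDd ▸ hPd)
      obtain ⟨r, hr⟩ := Nat.exists_eq_add_one_of_ne_zero hm0
      have hs : s < p * s := lt_mul_of_one_lt_left
        (Nat.pos_of_ne_zero (right_ne_zero_of_mul hm0)) hp.one_lt
      obtain ⟨t, ht⟩ : ∃ t, p * s = s + t + 1 := ⟨p * s - s - 1, by omega⟩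
      obtain ⟨y, hy⟩ := exists_pow_eq (p := p) (AdjoinRoot P)
        (AdjoinRoot.mk P D.num * (AdjoinRoot.mk P C₀)⁻¹)
      obtain ⟨W, rfl⟩ := AdjoinRoot.mk_surjective y
      obtain ⟨N, hN⟩ : P ∣ D.num - W ^ p * C₀ := by
        rw [← AdjoinRoot.mk_eq_zero, map_sub, map_mul, map_pow, hy,
          inv_mul_cancel_right₀ (mk_ne_zero hPC), sub_self]
      have hP0 := RatFunc.algebraMap_ne_zero hP.ne_zero
      have hC0 := RatFunc.algebraMap_ne_zero hC.ne_zero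
      have heq : D = algebraMap F[X] (RatFunc F) (N + W * P ^ t * C₀) /
            algebraMap F[X] (RatFunc F) (P ^ r * C₀) +
          ((algebraMap F[X] (RatFunc F) W / algebraMap F[X] (RatFunc F) P ^ s) ^ p -
            algebraMap F[X] (RatFunc F) W / algebraMap F[X] (RatFunc F) P ^ s) := by
        have hN' := congrArg (algebraMap F[X] (RatFunc F)) hN
        simp only [map_sub, map_mul, map_pow] at hN'
        conv_lhs => rw [← RatFunc.num_div_denom D, hDd]
        obtain rfl : r = s + t := by omega
        simp only [map_add, map_mul, map_pow, div_pow]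
        rw [← pow_mul, mul_comm s p, ht]
        field_simp
        linear_combination algebraMap F[X] (RatFunc F) P ^ (2 * s + t) * hN'
      have hlt : (algebraMap F[X] (RatFunc F) (N + W * P ^ t * C₀) /
          algebraMap F[X] (RatFunc F) (P ^ r * C₀)).denom.natDegree < d := by
        refine (natDegree_le_of_dvd (RatFunc.denom_div_dvd _ _)
          ((hP.pow r).mul hC).ne_zero).trans_lt ?_
        rw [← hd, hDd, (hP.pow r).natDegree_mul hC, (hP.pow _).natDegree_mul hC, hP.natDegree_pow,
          hP.natDegree_pow, hr]
        have := hPi.natDegree_pos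
        gcongr
        exact Nat.lt_succ_self r
      rcases ih _ hlt _ rfl with h | ⟨G, c, h⟩
      · rw [heq]
        exact .inl (h.add_pow_sub _)
      · refine .inr ⟨G + algebraMap F[X] (RatFunc F) W / algebraMap F[X] (RatFunc F) P ^ s, c, ?_⟩
        rw [heq, h, add_pow_char]
        ring
    · exact .inl (hasZeroMean_of_pole hP hPi hC hPC hm hDd)

end Reduction

section Density

variable {p : ℕ} [Fact p.Prime] {F : Type} [Field F] [Fintype F] [Algebra (ZMod p) F]

theorem eventually_card_irreds_ne_zero : ∀ᶠ n in atTop, (irreds F n).card ≠ 0 := by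
  filter_upwards [eventually_ge_atTop 3] with n hn h0
  have h := pow_card_le (F := F) n (by omega)
  rw [h0, mul_zero, zero_add] at h
  have := (Nat.pow_le_pow_iff_right (Fintype.one_lt_card (α := F))).1 h
  omega

theorem tendsto_mean_of_pow_sub (G : RatFunc F) :
    Tendsto (fun n ↦ (∑ P ∈ irreds F n, (ZMod.stdAddChar (hasseSymbol p P (G ^ p - G)) : ℂ)) /
      ((irreds F n).card : ℂ)) atTop (nhds 1) := by
  refine tendsto_const_nhds.congr' ?_
  filter_upwards [eventually_card_irreds_ne_zero (F := F), eventually_not_dvd G.denom_ne_zero]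
    with n hn hG
  have h : ∀ P ∈ irreds F n, (ZMod.stdAddChar (hasseSymbol p P (G ^ p - G)) : ℂ) = 1 := by
    intro P hP
    have : Fact (Irreducible P) := ⟨(mem_irreds.1 hP).2⟩
    rw [(hasseSymbol_pow_sub (mem_irreds.1 hP).1.1 (hG P hP)).2, AddChar.map_zero_eq_one]
  rw [Finset.sum_congr rfl h, Finset.sum_const, nsmul_one, div_self (Nat.cast_ne_zero.2 hn)]

open scoped Classical in
theorem sum_stdAddChar_eq_ite {ι : Type*} [Fintype ι] (h : ι → ZMod p) :
    ∑ a : ι → ZMod p, (ZMod.stdAddChar (∑ i, a i * h i) : ℂ) =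
      if ∀ i, h i = 0 then (p : ℂ) ^ Fintype.card ι else 0 := by
  have h1 : ∀ a : ι → ZMod p, (ZMod.stdAddChar (∑ i, a i * h i) : ℂ) =
      ∏ i, (ZMod.stdAddChar (a i * h i) : ℂ) := fun a ↦
    map_prod (ZMod.stdAddChar (N := p)).toMonoidHom (fun i ↦ Multiplicative.ofAdd (a i * h i)) _
  simp_rw [h1]
  rw [← Fintype.piFinset_univ,
    ← Finset.prod_univ_sum (fun _ ↦ Finset.univ) fun i x ↦ (ZMod.stdAddChar (x * h i) : ℂ)]
  simp_rw [AddChar.sum_mulShift _ (ZMod.isPrimitive_stdAddChar p), ZMod.card]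
  split_ifs with h0
  · simp [h0]
  · obtain ⟨i, hi⟩ := not_forall.1 h0
    exact Finset.prod_eq_zero (Finset.mem_univ i) (by simp [hi])

open scoped Classical in
/-- The relative density of the primes at which all the Hasse symbols of the `D i` vanish, provided
every nontrivial combination of the `D i` has Hasse symbols that are zero on average. -/
theorem tendsto_density {ι : Type*} [Fintype ι] (D : ι → RatFunc F)
    (h : ∀ a : ι → ZMod p, HasZeroMean p (∑ i, ((a i).val : RatFunc F) * D i) ∨
      ∃ G : RatFunc F, ∑ i, ((a i).val : RatFunc F) * D i = G ^ p - G) :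
    Tendsto (fun n ↦ (((irreds F n).filter fun P ↦
        (∀ i, ¬ P ∣ (D i).denom) ∧ ∀ i, hasseSymbol p P (D i) = 0).card : ℝ) /
          ((irreds F n).card : ℝ)) atTop
      (nhds (((Finset.univ.filter fun a : ι → ZMod p ↦
        ∃ G : RatFunc F, ∑ i, ((a i).val : RatFunc F) * D i = G ^ p - G).card : ℝ) /
          (p : ℝ) ^ Fintype.card ι)) := by
  have hp0 : (p : ℂ) ^ Fintype.card ι ≠ 0 :=
    pow_ne_zero _ (Nat.cast_ne_zero.2 (Fact.out : p.Prime).ne_zero)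
  have hlim : Tendsto (fun n ↦ (∑ a : ι → ZMod p, (∑ P ∈ irreds F n,
      (ZMod.stdAddChar (hasseSymbol p P (∑ i, ((a i).val : RatFunc F) * D i)) : ℂ)) /
        ((irreds F n).card : ℂ)) / (p : ℂ) ^ Fintype.card ι) atTop
      (nhds ((∑ a : ι → ZMod p, if ∃ G : RatFunc F, ∑ i, ((a i).val : RatFunc F) * D i = G ^ p - G
        then 1 else 0) / (p : ℂ) ^ Fintype.card ι)) := by
    refine (tendsto_finsetSum _ fun a _ ↦ ?_).div_const _
    split_ifs with ha
    · obtain ⟨G, hG⟩ := ha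
      rw [hG]
      exact tendsto_mean_of_pow_sub G
    · exact (h a).resolve_right ha
  rw [Finset.sum_boole] at hlim
  have hre := (Complex.continuous_re.tendsto _).comp hlim
  have hval : ∀ m n : ℕ, ((m : ℂ) / (n : ℂ) ^ Fintype.card ι).re =
      (m : ℝ) / (n : ℝ) ^ Fintype.card ι := by
    intro m n
    rw [← Complex.ofReal_natCast, ← Complex.ofReal_natCast, ← Complex.ofReal_pow,
      ← Complex.ofReal_div, Complex.ofReal_re]
  rw [hval] at hre
  refine hre.congr' ?_
  have hdvd : ∀ᶠ n in atTop, ∀ i, ∀ P ∈ irreds F n, ¬ P ∣ (D i).denom :=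
    eventually_all.2 fun i ↦ eventually_not_dvd (D i).denom_ne_zero
  filter_upwards [hdvd] with n hn
  have hP : ∀ P ∈ irreds F n, ∑ a : ι → ZMod p,
      (ZMod.stdAddChar (hasseSymbol p P (∑ i, ((a i).val : RatFunc F) * D i)) : ℂ) =
        if (∀ i, ¬ P ∣ (D i).denom) ∧ ∀ i, hasseSymbol p P (D i) = 0
          then (p : ℂ) ^ Fintype.card ι else 0 := by
    intro P hP
    have : Fact (Irreducible P) := ⟨(mem_irreds.1 hP).2⟩
    have hd : ∀ i, ¬ P ∣ (D i).denom := fun i ↦ hn i P hP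
    simp_rw [hasseSymbol_sum Finset.univ _ fun i _ ↦ hd i, sum_stdAddChar_eq_ite]
    simp only [hd, not_false_eq_true, implies_true, true_and]
  rw [Function.comp_apply, ← Finset.sum_div, Finset.sum_comm, Finset.sum_congr rfl hP,
    ← Finset.sum_filter, Finset.sum_const, nsmul_eq_mul, div_right_comm,
    mul_div_cancel_right₀ _ hp0, ← Complex.ofReal_natCast, ← Complex.ofReal_natCast,
    ← Complex.ofReal_div, Complex.ofReal_re]

omit [Fintype F] in
/-- In an Artin–Schreier extension without new constants, a combination of the `D i` which agrees
with a constant up to some `G ^ p - G` is itself of the form `G ^ p - G`. -/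
theorem exists_eq_pow_sub {ι : Type*} [Fintype ι] {D : ι → RatFunc F} {K : Type*} [Field K]
    [Algebra (RatFunc F) K] [Algebra F K] [IsScalarTower F (RatFunc F) K] {α : ι → K}
    (hα : ∀ i, α i ^ p - α i = algebraMap (RatFunc F) K (D i))
    (hgeo : ∀ x : K, IsAlgebraic F x → ∃ c : F, algebraMap F K c = x)
    (a : ι → ZMod p) {G : RatFunc F} {c : F}
    (h : ∑ i, ((a i).val : RatFunc F) * D i = G ^ p - G + algebraMap F[X] (RatFunc F) (C c)) :
    ∃ G' : RatFunc F, ∑ i, ((a i).val : RatFunc F) * D i = G' ^ p - G' := by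
  have hp : p.Prime := Fact.out
  have : CharP F p := charP_of_injective_algebraMap (algebraMap (ZMod p) F).injective p
  have : CharP (RatFunc F) p := charP_of_injective_algebraMap (algebraMap F (RatFunc F)).injective p
  have : CharP K p := charP_of_injective_algebraMap (algebraMap F K).injective p
  have hC : ∀ b : F, algebraMap F[X] (RatFunc F) (C b) = algebraMap F (RatFunc F) b := fun b ↦
    (IsScalarTower.algebraMap_apply F F[X] (RatFunc F) b).symm
  rw [hC] at h
  obtain ⟨β, hβ⟩ : ∃ β : K, β = ∑ i, ((a i).val : K) * α i - algebraMap (RatFunc F) K G := ⟨_, rfl⟩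
  have hβc : β ^ p - β = algebraMap F K c := by
    have hcast : ∀ n : ℕ, (n : K) ^ p = n := fun n ↦ by
      rw [← map_natCast (ZMod.castHom dvd_rfl K) n, ← map_pow, ZMod.pow_card]
    have h' := congrArg (algebraMap (RatFunc F) K) h
    rw [map_sum, map_add, map_sub, map_pow, ← IsScalarTower.algebraMap_apply] at h'
    simp only [map_mul, map_natCast, ← hα, mul_sub, Finset.sum_sub_distrib] at h'
    rw [hβ, sub_pow_char, sum_pow_char]
    simp only [mul_pow, hcast]
    linear_combination h'
  have halg : IsAlgebraic F β := by
    refine IsIntegral.isAlgebraic ⟨X ^ p - X - C c, ?_, ?_⟩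
    · rw [sub_sub]
      refine monic_X_pow_sub ((degree_X_add_C c).trans_lt ?_)
      exact_mod_cast hp.one_lt
    · simp [hβc]
  obtain ⟨b, rfl⟩ := hgeo β halg
  rw [← map_pow, ← map_sub] at hβc
  refine ⟨G + algebraMap F (RatFunc F) b, ?_⟩
  rw [h, ← (algebraMap F K).injective hβc, add_pow_char, map_sub, map_pow]
  ring

end Density

end HasseDensity

/-- **Relative density of simultaneous vanishing of Hasse symbols (Theorem 3.5).**
Let `q` be a power of a prime `p`, `k = F_q(t)`, and `S = {D_1,...,D_l}` nonzero elements
of `k` such that `K = k(α_1,...,α_l)`, with `α_i^p − α_i = D_i`, is a geometric extension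
of `k`.  Let `γ_S` be the cardinality of
`{(a_1,...,a_l) ∈ F_p^l : a_1 D_1 + ⋯ + a_l D_l = F^p − F for some F ∈ k}`.
Let `M` be the set of monic irreducible `P ∈ F_q[t]` (not dividing any denominator of the
`D_i`) with `{D_1/P} = ⋯ = {D_l/P} = 0`.  Then the relative density of `M` exists and
equals `γ_S / p^l`, i.e. `#{P ∈ M : deg P = N}/π(N) → γ_S/p^l` as `N → ∞`. -/
theorem artinSchreier_relative_density
    (p e : ℕ) (hp : p.Prime) (he : 0 < e)
    (Fq : Type) [Field Fq] [Fintype Fq] (hq : Fintype.card Fq = p ^ e)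
    [Algebra (ZMod p) Fq]
    (l : ℕ) (D : Fin l → RatFunc Fq) (hD : ∀ i, D i ≠ 0)
    -- `K = k(α_1,...,α_l)` with `α_i^p − α_i = D_i`, a geometric extension of `k`
    (K : Type) [Field K] [Algebra (RatFunc Fq) K] [Algebra Fq K]
    [IsScalarTower Fq (RatFunc Fq) K]
    (α : Fin l → K)
    (hα : ∀ i, α i ^ p - α i = algebraMap (RatFunc Fq) K (D i))
    (hgen : Algebra.adjoin (RatFunc Fq) (Set.range α) = ⊤)
    (hgeo : ∀ x : K, IsAlgebraic Fq x → ∃ c : Fq, algebraMap Fq K c = x) :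
    Tendsto (fun N : ℕ =>
        (Nat.card {P : Polynomial Fq //
            P.Monic ∧ Irreducible P ∧ P.natDegree = N ∧
              (∀ i, ¬ P ∣ (D i).denom) ∧ ∀ i, hasseSymbol p P (D i) = 0} : ℝ) /
          (Nat.card {P : Polynomial Fq // P.Monic ∧ Irreducible P ∧ P.natDegree = N} : ℝ))
      atTop
      (nhds ((Nat.card {a : Fin l → ZMod p //
          ∃ F : RatFunc Fq, (∑ i, ((a i).val : RatFunc Fq) * D i) = F ^ p - F} : ℝ) /
        (p : ℝ) ^ l)) := by
  classical
  have : Fact p.Prime := ⟨hp⟩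
  have h := HasseDensity.tendsto_density D fun a ↦
    (HasseDensity.hasZeroMean_or (∑ i, ((a i).val : RatFunc Fq) * D i)).imp_right
      fun ⟨_, _, h⟩ ↦ HasseDensity.exists_eq_pow_sub hα hgeo a h
  rw [Fintype.card_fin] at h
  convert h using 4 with N
  · refine Nat.subtype_card _ fun P ↦ ?_
    simp only [Finset.mem_filter, HasseDensity.mem_irreds]
    tauto
  · refine Nat.subtype_card _ fun P ↦ ?_
    rw [HasseDensity.mem_irreds]
    tauto
  · refine Nat.subtype_card _ fun a ↦ ?_
    simp
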